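/- Set d = 3 and let W be a 3-dimensional complex vector space and W' a 6-dimensional complex vector space. Then there are isomorphisms of graded algebras Sym^•(S_{(3,1,0)}W)/⟨S_{(4,3,1)}W⟩ ≅ Sym^•(⋀²(Sym²W))/⟨⋀⁴(Sym²W)⟩ ≅ Sym^•(⋀²W')/⟨⋀⁴W'⟩, the last being the homogeneous coordinate ring of (the cone over) the Plücker embedding of the Grassmannian G(2,6). -/

import Mathlib

open TensorProduct PiTensorProduct

noncomputable section

/-- The action of a permutation `σ ∈ S_n` on the `n`-th tensor power `⨂ⁿ W`. -/
def permAct (W : Type) [AddCommGroup W] [Module ℂ W] (n : ℕ) (σ : Equiv.Perm (Fin n)) :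
    (⨂[ℂ]^n W) →ₗ[ℂ] ⨂[ℂ]^n W :=
  (PiTensorProduct.reindex ℂ (fun _ : Fin n => W) σ).toLinearMap

/-- The map `⨂ⁿ W → ⨂ⁿ W` induced functorially by a linear map `g : W → W`
(the action of `GL(W)` on `⨂ⁿ W` when `g` is invertible). -/
def glAct (W : Type) [AddCommGroup W] [Module ℂ W] (n : ℕ) (g : W →ₗ[ℂ] W) :
    (⨂[ℂ]^n W) →ₗ[ℂ] ⨂[ℂ]^n W :=
  PiTensorProduct.map (fun _ : Fin n => g)

/-- The row index of the `k`-th box (boxes numbered `0,1,2,…` along the rows) of the Young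
diagram of a partition given by the list of its parts. -/
def rowIdx : List ℕ → ℕ → ℕ
  | [], _ => 0
  | a :: t, k => if k < a then 0 else rowIdx t (k - a) + 1

/-- The column index of the `k`-th box of the Young diagram of a partition. -/
def colIdx : List ℕ → ℕ → ℕ
  | [], k => k
  | a :: t, k => if k < a then k else colIdx t (k - a)

open scoped Classical in
/-- The Young symmetrizer of the partition `l` (with `l.sum = n`), as an endomorphism of
`⨂ⁿ W`: the sum `∑ sgn(σ) σ∘τ` over `σ` in the column group and `τ` in the row group of the
canonical tableau of `l`. -/
def youngSymmetrizer (W : Type) [AddCommGroup W] [Module ℂ W] (n : ℕ) (l : List ℕ) :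
    (⨂[ℂ]^n W) →ₗ[ℂ] ⨂[ℂ]^n W :=
  ∑ σ : Equiv.Perm (Fin n), ∑ τ : Equiv.Perm (Fin n),
    (if (∀ k : Fin n, colIdx l (σ k : ℕ) = colIdx l (k : ℕ)) ∧
        (∀ k : Fin n, rowIdx l (τ k : ℕ) = rowIdx l (k : ℕ))
      then ((Equiv.Perm.sign σ : ℤ) : ℂ) else 0) • (permAct W n σ ∘ₗ permAct W n τ)

/-- The Schur module `S_l W ⊆ ⨂ⁿ W` (for a partition `l` of `n`): the image of the Young
symmetrizer of `l`.  It is a `GL(W)`-subrepresentation of `⨂ⁿ W`. -/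
def SchurModule (W : Type) [AddCommGroup W] [Module ℂ W] (n : ℕ) (l : List ℕ) :
    Submodule ℂ (⨂[ℂ]^n W) :=
  LinearMap.range (youngSymmetrizer W n l)

open scoped Classical in
/-- The (un-normalized) projector onto a tensor product of exterior and symmetric powers inside
`⨂ⁿ W`: `blocks` is a list of pairs `(size, isAlternating)`; the endomorphism antisymmetrizes
the blocks marked `true` and symmetrizes the blocks marked `false`.  Its image is
`⋀^{a₁} W ⊗ Sym^{a₂} W ⊗ ⋯` (according to the flags) viewed inside `⨂ⁿ W`. -/
def blockSym (W : Type) [AddCommGroup W] [Module ℂ W] (n : ℕ) (blocks : List (ℕ × Bool)) :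
    (⨂[ℂ]^n W) →ₗ[ℂ] ⨂[ℂ]^n W :=
  (∑ σ : Equiv.Perm (Fin n),
    (if (∀ k : Fin n, rowIdx (blocks.map Prod.fst) (σ k : ℕ)
          = rowIdx (blocks.map Prod.fst) (k : ℕ)) ∧
        (∀ k : Fin n, (blocks.getD (rowIdx (blocks.map Prod.fst) (k : ℕ)) (0, false)).2 = false
          → σ k = k)
      then ((Equiv.Perm.sign σ : ℤ) : ℂ) else 0) • permAct W n σ) ∘ₗ
  (∑ τ : Equiv.Perm (Fin n),
    (if (∀ k : Fin n, rowIdx (blocks.map Prod.fst) (τ k : ℕ)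
          = rowIdx (blocks.map Prod.fst) (k : ℕ)) ∧
        (∀ k : Fin n, (blocks.getD (rowIdx (blocks.map Prod.fst) (k : ℕ)) (0, false)).2 = true
          → τ k = k)
      then (1 : ℂ) else 0) • permAct W n τ)

/-- The submodule of `⨂ⁿ W` realizing the tensor product of exterior/symmetric powers of `W`
prescribed by `blocks`. -/
def BlockModule (W : Type) [AddCommGroup W] [Module ℂ W] (n : ℕ) (blocks : List (ℕ × Bool)) :
    Submodule ℂ (⨂[ℂ]^n W) :=
  LinearMap.range (blockSym W n blocks)

end

open TensorProduct

noncomputable section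

/-- The relation on the tensor algebra whose quotient is the symmetric algebra `Sym^•(M)`. -/
def symRel (M : Type) [AddCommGroup M] [Module ℂ M] :
    TensorAlgebra ℂ M → TensorAlgebra ℂ M → Prop :=
  fun a b => ∃ x y : M, a = TensorAlgebra.ι ℂ x * TensorAlgebra.ι ℂ y ∧
    b = TensorAlgebra.ι ℂ y * TensorAlgebra.ι ℂ x

/-- The symmetric algebra `Sym^•(M)` of a `ℂ`-module `M`. -/
abbrev SymmAlgebra (M : Type) [AddCommGroup M] [Module ℂ M] : Type :=
  RingQuot (symRel M)

/-- The canonical inclusion `M → Sym^•(M)` of the degree-one part. -/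
def ιSym (M : Type) [AddCommGroup M] [Module ℂ M] : M →ₗ[ℂ] SymmAlgebra M :=
  (RingQuot.mkAlgHom ℂ (symRel M)).toLinearMap ∘ₗ TensorAlgebra.ι ℂ

/-- The quotient of a `ℂ`-algebra by the two-sided ideal generated by a subset `U`. -/
abbrev quotBy (A : Type) [Ring A] [Algebra ℂ A] (U : Set A) : Type :=
  RingQuot (fun a b : A => a ∈ U ∧ b = 0)

/-- The image of the degree-one part `M` in the quotient `Sym^•(M)/⟨U⟩`. -/
def gen₁ (M : Type) [AddCommGroup M] [Module ℂ M] (U : Set (SymmAlgebra M)) :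
    M →ₗ[ℂ] quotBy (SymmAlgebra M) U :=
  (RingQuot.mkAlgHom ℂ (fun a b : SymmAlgebra M => a ∈ U ∧ b = 0)).toLinearMap ∘ₗ ιSym M

/-- The canonical equivalence `(⨂^p M) ⊗ (⨂^q M) ≃ ⨂^{p+q} M`. -/
def tensorPowMul (M : Type) [AddCommGroup M] [Module ℂ M] (p q : ℕ) :
    ((⨂[ℂ]^p M) ⊗[ℂ] (⨂[ℂ]^q M)) ≃ₗ[ℂ] ⨂[ℂ]^(p + q) M :=
  (PiTensorProduct.tmulEquiv (R := ℂ) (M := M)).trans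
    (PiTensorProduct.reindex ℂ (fun _ : Fin p ⊕ Fin q => M) finSumFinEquiv)

/-- Given a linear map `j : ⨂^p M → A` into a `ℂ`-algebra, the induced degree-two
multiplication map `⨂^{2p} M → A`, `v ⊗ w ↦ j(v) * j(w)`. -/
def mulTwo (M : Type) [AddCommGroup M] [Module ℂ M] (p : ℕ) (A : Type) [Ring A]
    [Algebra ℂ A] (j : (⨂[ℂ]^p M) →ₗ[ℂ] A) : (⨂[ℂ]^(p + p) M) →ₗ[ℂ] A :=
  TensorProduct.lift (((LinearMap.mul ℂ A).comp j).compl₂ j) ∘ₗ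
    (tensorPowMul M p p).symm.toLinearMap

/-- `Sym² W`, realized inside `⨂² W`. -/
def Sym2Sub (W : Type) [AddCommGroup W] [Module ℂ W] : Submodule ℂ (⨂[ℂ]^2 W) :=
  BlockModule W 2 [(2, false)]

set_option synthInstance.maxHeartbeats 4000000 in
instance instSym2TP2acg (W : Type) [AddCommGroup W] [Module ℂ W] :
    AddCommGroup (⨂[ℂ]^2 ↥(Sym2Sub W)) := inferInstance

set_option synthInstance.maxHeartbeats 4000000 in
instance instSym2TP2mod (W : Type) [AddCommGroup W] [Module ℂ W] :
    Module ℂ (⨂[ℂ]^2 ↥(Sym2Sub W)) := inferInstance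

set_option synthInstance.maxHeartbeats 4000000 in
instance instSym2TP4acg (W : Type) [AddCommGroup W] [Module ℂ W] :
    AddCommGroup (⨂[ℂ]^4 ↥(Sym2Sub W)) := inferInstance

set_option synthInstance.maxHeartbeats 4000000 in
instance instSym2TP4mod (W : Type) [AddCommGroup W] [Module ℂ W] :
    Module ℂ (⨂[ℂ]^4 ↥(Sym2Sub W)) := inferInstance

set_option synthInstance.maxHeartbeats 4000000 in
instance instSym2TP22acg (W : Type) [AddCommGroup W] [Module ℂ W] :
    AddCommGroup (⨂[ℂ]^(2 + 2) ↥(Sym2Sub W)) := instSym2TP4acg W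

set_option synthInstance.maxHeartbeats 4000000 in
instance instSym2TP22mod (W : Type) [AddCommGroup W] [Module ℂ W] :
    Module ℂ (⨂[ℂ]^(2 + 2) ↥(Sym2Sub W)) := instSym2TP4mod W

/-- `⋀²(Sym² W)`, realized inside `⨂²(Sym² W)`. -/
def Wedge2Sym2 (W : Type) [AddCommGroup W] [Module ℂ W] :
    Submodule ℂ (⨂[ℂ]^2 ↥(Sym2Sub W)) := BlockModule (↥(Sym2Sub W)) 2 [(2, true)]

/-- `S_{(4,3,1)} W ⊂ Sym²(S_{(3,1,0)} W)`: the image of the realization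
`S_{(4,3,1)} W ⊆ ⨂⁸ W` under the canonical projection-and-multiplication map. -/
def U₁ (W : Type) [AddCommGroup W] [Module ℂ W] :
    Submodule ℂ (SymmAlgebra ↥(SchurModule W 4 [3, 1, 0])) :=
  Submodule.map
    (mulTwo W 4 _ (ιSym ↥(SchurModule W 4 [3, 1, 0]) ∘ₗ
      (youngSymmetrizer W 4 [3, 1, 0]).rangeRestrict))
    (SchurModule W 8 [4, 3, 1])

/-- `⋀⁴(Sym² W) ⊂ Sym²(⋀²(Sym² W))`: the image of `⋀⁴(Sym²W) ⊆ ⨂⁴(Sym²W)` under the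
canonical (Plücker) projection-and-multiplication map. -/
def U₂ (W : Type) [AddCommGroup W] [Module ℂ W] :
    Submodule ℂ (SymmAlgebra ↥(Wedge2Sym2 W)) :=
  Submodule.map
    (mulTwo (↥(Sym2Sub W)) 2 _ (ιSym ↥(Wedge2Sym2 W) ∘ₗ
      (blockSym (↥(Sym2Sub W)) 2 [(2, true)]).rangeRestrict))
    (BlockModule (↥(Sym2Sub W)) 4 [(4, true)])

/-- `⋀⁴ W' ⊂ Sym²(⋀² W')`, via the canonical (Plücker) projection-and-multiplication map. -/
def U₃ (W' : Type) [AddCommGroup W'] [Module ℂ W'] :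
    Submodule ℂ (SymmAlgebra ↥(BlockModule W' 2 [(2, true)])) :=
  Submodule.map
    (mulTwo W' 2 _ (ιSym ↥(BlockModule W' 2 [(2, true)]) ∘ₗ
      (blockSym W' 2 [(2, true)]).rangeRestrict))
    (BlockModule W' 4 [(4, true)])

/-! ### Symmetric algebras and their quotients -/

section SymmetricAlgebras

variable {M N A : Type} [AddCommGroup M] [Module ℂ M] [AddCommGroup N] [Module ℂ N]
  [Ring A] [Algebra ℂ A]

theorem ιSym_mul_comm (x y : M) : ιSym M x * ιSym M y = ιSym M y * ιSym M x := by
  simp only [ιSym, LinearMap.comp_apply, AlgHom.toLinearMap_apply, ← map_mul]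
  exact RingQuot.mkAlgHom_rel ℂ ⟨x, y, rfl, rfl⟩

/-- The multiplication `M × M → Sym² M ⊆ Sym^•(M)`. -/
def symMul (M : Type) [AddCommGroup M] [Module ℂ M] : M →ₗ[ℂ] M →ₗ[ℂ] SymmAlgebra M :=
  ((LinearMap.mul ℂ (SymmAlgebra M)).comp (ιSym M)).compl₂ (ιSym M)

theorem symMul_apply (x y : M) : symMul M x y = ιSym M x * ιSym M y := rfl

theorem symMul_comm (x y : M) : symMul M x y = symMul M y x := ιSym_mul_comm x y

/-- The universal property of the symmetric algebra. -/
def symLift (f : M →ₗ[ℂ] A) (hf : ∀ x y, f x * f y = f y * f x) : SymmAlgebra M →ₐ[ℂ] A :=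
  RingQuot.liftAlgHom ℂ ⟨TensorAlgebra.lift ℂ f, by
    rintro _ _ ⟨x, y, rfl, rfl⟩
    simpa using hf x y⟩

@[simp]
theorem symLift_ιSym (f : M →ₗ[ℂ] A) (hf : ∀ x y, f x * f y = f y * f x) (x : M) :
    symLift f hf (ιSym M x) = f x := by
  simp [symLift, ιSym]

theorem symmAlgebra_hom_ext {f g : SymmAlgebra M →ₐ[ℂ] A}
    (h : ∀ x, f (ιSym M x) = g (ιSym M x)) : f = g := by
  apply RingQuot.ringQuot_ext'
  apply TensorAlgebra.hom_ext
  ext x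
  exact h x

/-- The isomorphism of symmetric algebras induced by a linear equivalence. -/
def symCongr (φ : M ≃ₗ[ℂ] N) : SymmAlgebra M ≃ₐ[ℂ] SymmAlgebra N :=
  AlgEquiv.ofAlgHom
    (symLift (ιSym N ∘ₗ φ.toLinearMap) fun _ _ => ιSym_mul_comm _ _)
    (symLift (ιSym M ∘ₗ φ.symm.toLinearMap) fun _ _ => ιSym_mul_comm _ _)
    (symmAlgebra_hom_ext fun x => by simp)
    (symmAlgebra_hom_ext fun x => by simp)

@[simp]
theorem symCongr_ιSym (φ : M ≃ₗ[ℂ] N) (x : M) : symCongr φ (ιSym M x) = ιSym N (φ x) := by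
  simp [symCongr]

theorem symCongr_symMul (φ : M ≃ₗ[ℂ] N) (x y : M) :
    symCongr φ (symMul M x y) = symMul N (φ x) (φ y) := by
  simp [symMul_apply]

/-- The homomorphism of quotient algebras induced by a homomorphism of algebras. -/
def quotByMap {B : Type} [Ring B] [Algebra ℂ B] (f : A →ₐ[ℂ] B) (U : Set A) (U' : Set B)
    (h : ∀ u ∈ U, f u ∈ U') : quotBy A U →ₐ[ℂ] quotBy B U' :=
  RingQuot.liftAlgHom ℂ ⟨(RingQuot.mkAlgHom ℂ fun a b : B => a ∈ U' ∧ b = 0).comp f, by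
    rintro x _ ⟨hx, rfl⟩
    simpa using RingQuot.mkAlgHom_rel ℂ (s := fun a b : B => a ∈ U' ∧ b = 0)
      ⟨h x hx, rfl⟩⟩

theorem quotByMap_mk {B : Type} [Ring B] [Algebra ℂ B] (f : A →ₐ[ℂ] B) (U : Set A) (U' : Set B)
    (h : ∀ u ∈ U, f u ∈ U') (x : A) :
    quotByMap f U U' h (RingQuot.mkAlgHom ℂ (fun a b : A => a ∈ U ∧ b = 0) x) =
      RingQuot.mkAlgHom ℂ (fun a b : B => a ∈ U' ∧ b = 0) (f x) := by
  simp [quotByMap]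

/-- A linear equivalence carrying the relations `U` onto the relations `U'` induces a graded
isomorphism of the quotients of the symmetric algebras. -/
theorem exists_quotBy_algEquiv (φ : M ≃ₗ[ℂ] N) (U : Submodule ℂ (SymmAlgebra M))
    (U' : Submodule ℂ (SymmAlgebra N)) (h : U.map (symCongr φ).toLinearMap = U') :
    ∃ e : quotBy (SymmAlgebra M) (U : Set (SymmAlgebra M)) ≃ₐ[ℂ]
        quotBy (SymmAlgebra N) (U' : Set (SymmAlgebra N)),
      Submodule.map e.toLinearMap (LinearMap.range (gen₁ M (U : Set (SymmAlgebra M)))) =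
        LinearMap.range (gen₁ N (U' : Set (SymmAlgebra N))) := by
  have h₁ : ∀ u ∈ (U : Set (SymmAlgebra M)),
      (symCongr φ).toAlgHom u ∈ (U' : Set (SymmAlgebra N)) :=
    fun u hu => h ▸ Submodule.mem_map_of_mem hu
  have h₂ : ∀ u ∈ (U' : Set (SymmAlgebra N)),
      (symCongr φ).symm.toAlgHom u ∈ (U : Set (SymmAlgebra M)) := by
    rintro u hu
    rw [← h] at hu
    obtain ⟨v, hv, rfl⟩ := hu
    simpa using hv
  let f := quotByMap (symCongr φ).toAlgHom _ _ h₁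
  let g := quotByMap (symCongr φ).symm.toAlgHom _ _ h₂
  have hfg : f.comp g = AlgHom.id ℂ _ := by
    apply RingQuot.ringQuot_ext'
    refine AlgHom.ext fun x => ?_
    simp [f, g, quotByMap_mk]
  have hgf : g.comp f = AlgHom.id ℂ _ := by
    apply RingQuot.ringQuot_ext'
    refine AlgHom.ext fun x => ?_
    simp [f, g, quotByMap_mk]
  have hgen : ∀ x, f (gen₁ M (U : Set (SymmAlgebra M)) x) =
      gen₁ N (U' : Set (SymmAlgebra N)) (φ x) := by
    intro x
    simp [f, gen₁, quotByMap_mk]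
  refine ⟨AlgEquiv.ofAlgHom f g hfg hgf, le_antisymm ?_ ?_⟩
  · rintro _ ⟨_, ⟨x, rfl⟩, rfl⟩
    exact ⟨φ x, (hgen x).symm⟩
  · rintro _ ⟨y, rfl⟩
    refine ⟨_, ⟨φ.symm y, rfl⟩, ?_⟩
    simpa using hgen (φ.symm y)

end SymmetricAlgebras

/-! ### Permutations of tensors -/

section Permutations

variable {V : Type} [AddCommGroup V] [Module ℂ V]

@[simp]
theorem permAct_tprod (n : ℕ) (σ : Equiv.Perm (Fin n)) (v : Fin n → V) :
    permAct V n σ (tprod ℂ v) = tprod ℂ (fun i => v (σ.symm i)) := by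
  simp [permAct]

theorem tensorPowMul_tmul_tprod (p q : ℕ) (v : Fin (p + q) → V) :
    tensorPowMul V p q ((tprod ℂ fun i => v (Fin.castAdd q i)) ⊗ₜ
      (tprod ℂ fun i => v (Fin.natAdd p i))) = tprod ℂ v := by
  simp only [tensorPowMul, LinearEquiv.trans_apply, tmulEquiv_apply, reindex_tprod]
  congr 1
  ext i
  refine Fin.addCases (fun i => ?_) (fun i => ?_) i
  · simp
  · rw [finSumFinEquiv_symm_apply_natAdd]
    rfl

theorem tensorPowMul_symm_tprod (p q : ℕ) (v : Fin (p + q) → V) :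
    (tensorPowMul V p q).symm (tprod ℂ v) = (tprod ℂ fun i => v (Fin.castAdd q i)) ⊗ₜ
      (tprod ℂ fun i => v (Fin.natAdd p i)) := by
  rw [LinearEquiv.symm_apply_eq, tensorPowMul_tmul_tprod]

theorem mulTwo_tprod {A : Type} [Ring A] [Algebra ℂ A] (p : ℕ) (j : (⨂[ℂ]^p V) →ₗ[ℂ] A)
    (v : Fin (p + p) → V) :
    mulTwo V p A j (tprod ℂ v) = j (tprod ℂ fun i => v (Fin.castAdd p i)) *
      j (tprod ℂ fun i => v (Fin.natAdd p i)) := by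
  rw [mulTwo, LinearMap.comp_apply, LinearEquiv.coe_coe, tensorPowMul_symm_tprod]
  simp

theorem tensorPower_le_comap {X : Type} [AddCommGroup X] [Module ℂ X] {n : ℕ}
    (f : (⨂[ℂ]^n V) →ₗ[ℂ] X) (S : Submodule ℂ X) (h : ∀ v, f (tprod ℂ v) ∈ S) (x) : f x ∈ S := by
  have : (⊤ : Submodule ℂ (⨂[ℂ]^n V)) ≤ S.comap f := by
    rw [← span_tprod_eq_top, Submodule.span_le]
    rintro _ ⟨v, rfl⟩
    exact h v
  exact this trivial

theorem blockSym_true_tprod (n : ℕ) (v : Fin n → V) :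
    blockSym V n [(n, true)] (tprod ℂ v) =
      ∑ σ : Equiv.Perm (Fin n), ((Equiv.Perm.sign σ : ℤ) : ℂ) • tprod ℂ (fun i => v (σ i)) := by
  have h₂ : ∀ τ : Equiv.Perm (Fin n), (∀ k : Fin n, τ k = k) ↔ τ = 1 := fun τ => by
    simp [Equiv.ext_iff]
  simp only [blockSym, List.map_cons, List.map_nil, rowIdx, Fin.is_lt, if_true, List.getD_cons_zero,
    implies_true, true_and, Bool.true_eq_false, false_imp_iff, forall_true_left, h₂,
    ite_smul, one_smul, zero_smul, Finset.sum_ite_eq', Finset.mem_univ, LinearMap.comp_apply,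
    LinearMap.sum_apply, LinearMap.smul_apply, permAct_tprod]
  refine Fintype.sum_equiv (Equiv.inv _) _ _ fun σ => ?_
  simp [← Equiv.Perm.inv_def]

theorem blockSym_false_tprod (n : ℕ) (v : Fin n → V) :
    blockSym V n [(n, false)] (tprod ℂ v) =
      ∑ σ : Equiv.Perm (Fin n), tprod ℂ (fun i => v (σ i)) := by
  have h₂ : ∀ τ : Equiv.Perm (Fin n), (∀ k : Fin n, τ k = k) ↔ τ = 1 := fun τ => by
    simp [Equiv.ext_iff]
  simp only [blockSym, List.map_cons, List.map_nil, rowIdx, Fin.is_lt, if_true, List.getD_cons_zero,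
    implies_true, true_and, Bool.false_eq_true, false_imp_iff, forall_true_left, h₂,
    ite_smul, one_smul, zero_smul, Finset.sum_ite_eq', Finset.mem_univ, LinearMap.comp_apply,
    LinearMap.sum_apply, LinearMap.smul_apply, permAct_tprod, map_sum, Equiv.Perm.sign_one]
  refine Fintype.sum_equiv (Equiv.inv _) _ _ fun σ => ?_
  simp [← Equiv.Perm.inv_def]

theorem sum_sign_perm_fin_four {X : Type} [AddCommGroup X] [Module ℂ X]
    (f : Fin 4 → Fin 4 → Fin 4 → Fin 4 → X) :
    ∑ σ : Equiv.Perm (Fin 4), ((Equiv.Perm.sign σ : ℤ) : ℂ) • f (σ 0) (σ 1) (σ 2) (σ 3) =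
      ((f 0 1 2 3 + -f 0 1 3 2) + (-f 0 2 1 3 + f 0 2 3 1) + (-f 0 3 2 1 + f 0 3 1 2)) +
      ((-f 1 0 2 3 + f 1 0 3 2) + (f 1 2 0 3 + -f 1 2 3 0) + (f 1 3 2 0 + -f 1 3 0 2)) +
      ((-f 2 1 0 3 + f 2 1 3 0) + (f 2 0 1 3 + -f 2 0 3 1) + (f 2 3 0 1 + -f 2 3 1 0)) +
      ((-f 3 1 2 0 + f 3 1 0 2) + (f 3 2 1 0 + -f 3 2 0 1) + (f 3 0 2 1 + -f 3 0 1 2)) := by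
  rw [← Equiv.Perm.decomposeFin.symm.sum_comp, Fintype.sum_prod_type]
  simp only [Fin.sum_univ_four, ← Equiv.Perm.decomposeFin.symm.sum_comp, Fintype.sum_prod_type,
    Fin.sum_univ_three, Fin.sum_univ_two, Finset.univ_unique, Finset.sum_singleton]
  simp
  rfl

end Permutations

/-! ### Exterior squares and Plücker relations -/

section Pluecker

variable {V : Type} [AddCommGroup V] [Module ℂ V]

/-- The exterior square `⋀² V`, realized inside `⨂² V`. -/
abbrev Wedge2 (V : Type) [AddCommGroup V] [Module ℂ V] : Submodule ℂ (⨂[ℂ]^2 V) :=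
  BlockModule V 2 [(2, true)]

/-- The canonical projection `⨂² V → ⋀² V`. -/
abbrev toWedge2 (V : Type) [AddCommGroup V] [Module ℂ V] : (⨂[ℂ]^2 V) →ₗ[ℂ] Wedge2 V :=
  (blockSym V 2 [(2, true)]).rangeRestrict

theorem tprod_pair_add_left (a b c : V) :
    tprod ℂ ![a + b, c] = tprod ℂ ![a, c] + tprod ℂ ![b, c] := by
  simpa using (tprod ℂ (s := fun _ : Fin 2 => V)).cons_add ![c] a b

theorem tprod_pair_add_right (a b c : V) :
    tprod ℂ ![a, b + c] = tprod ℂ ![a, b] + tprod ℂ ![a, c] := by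
  have h : ∀ x, Function.update ![a, 0] 1 x = ![a, x] := fun x => by
    ext i
    fin_cases i <;> rfl
  have := (tprod ℂ (s := fun _ : Fin 2 => V)).map_update_add ![a, 0] 1 b c
  rwa [h, h, h] at this

theorem tprod_pair_smul_left (r : ℂ) (a c : V) :
    tprod ℂ ![r • a, c] = r • tprod ℂ ![a, c] := by
  simpa using (tprod ℂ (s := fun _ : Fin 2 => V)).cons_smul ![c] r a

theorem tprod_pair_smul_right (r : ℂ) (a c : V) :
    tprod ℂ ![a, r • c] = r • tprod ℂ ![a, c] := by
  have h : ∀ x, Function.update ![a, 0] 1 x = ![a, x] := fun x => by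
    ext i
    fin_cases i <;> rfl
  have := (tprod ℂ (s := fun _ : Fin 2 => V)).map_update_smul ![a, 0] 1 r c
  rwa [h, h] at this

/-- The tensor product of two vectors, as a bilinear map. -/
def tprodPair (V : Type) [AddCommGroup V] [Module ℂ V] : V →ₗ[ℂ] V →ₗ[ℂ] ⨂[ℂ]^2 V :=
  LinearMap.mk₂ ℂ (fun a b => tprod ℂ ![a, b]) tprod_pair_add_left tprod_pair_smul_left
    tprod_pair_add_right tprod_pair_smul_right

theorem tprodPair_apply (a b : V) : tprodPair V a b = tprod ℂ ![a, b] := rfl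

theorem tprod_two (v : Fin 2 → V) : tprod ℂ v = tprodPair V (v 0) (v 1) := by
  rw [tprodPair_apply]
  congr 1
  ext i
  fin_cases i <;> rfl

/-- The wedge product `V × V → ⋀² V`. -/
def wedge (V : Type) [AddCommGroup V] [Module ℂ V] : V →ₗ[ℂ] V →ₗ[ℂ] Wedge2 V :=
  (tprodPair V).compr₂ (toWedge2 V)

theorem coe_wedge (a b : V) : (wedge V a b : ⨂[ℂ]^2 V) = tprodPair V a b - tprodPair V b a := by
  change blockSym V 2 [(2, true)] (tprod ℂ ![a, b]) = _
  have h : (Finset.univ : Finset (Equiv.Perm (Fin 2))) = {1, Equiv.swap 0 1} := by decide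
  rw [blockSym_true_tprod, h, Finset.sum_pair (by decide)]
  simp only [tprod_two]
  simp [sub_eq_add_neg]

theorem wedge_swap (a b : V) : wedge V a b = -wedge V b a := by
  ext
  simp [coe_wedge]

@[simp]
theorem wedge_self (a : V) : wedge V a a = 0 := by
  ext
  simp [coe_wedge]

theorem toWedge2_tprod (v : Fin 2 → V) : toWedge2 V (tprod ℂ v) = wedge V (v 0) (v 1) := by
  rw [tprod_two]
  rfl

theorem wedge2_hom_ext {X : Type} [AddCommGroup X] [Module ℂ X] {f g : Wedge2 V →ₗ[ℂ] X}
    (h : ∀ a b, f (wedge V a b) = g (wedge V a b)) : f = g := by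
  apply (LinearMap.cancel_right (LinearMap.surjective_rangeRestrict _)).1
  apply PiTensorProduct.ext
  ext v
  exact (congrArg f (toWedge2_tprod v)).trans ((h _ _).trans (congrArg g (toWedge2_tprod v)).symm)

/-- The Plücker relation `(a ∧ b)(c ∧ d) - (a ∧ c)(b ∧ d) + (a ∧ d)(b ∧ c)` for a bilinear
multiplication on `⋀² V`. -/
def pluecker {X : Type} [AddCommGroup X] [Module ℂ X] (B : Wedge2 V →ₗ[ℂ] Wedge2 V →ₗ[ℂ] X)
    (a b c d : V) : X :=
  B (wedge V a b) (wedge V c d) - B (wedge V a c) (wedge V b d) + B (wedge V a d) (wedge V b c)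

theorem sum_sign_perm_wedge {X : Type} [AddCommGroup X] [Module ℂ X]
    (B : Wedge2 V →ₗ[ℂ] Wedge2 V →ₗ[ℂ] X) (hB : ∀ x y, B x y = B y x) (v : Fin 4 → V) :
    ∑ σ : Equiv.Perm (Fin 4), ((Equiv.Perm.sign σ : ℤ) : ℂ) •
      B (wedge V (v (σ 0)) (v (σ 1))) (wedge V (v (σ 2)) (v (σ 3))) =
      (8 : ℂ) • pluecker B (v 0) (v 1) (v 2) (v 3) := by
  have h := fun x y => wedge_swap (V := V) (v x) (v y)
  rw [sum_sign_perm_fin_four fun i j k l =>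
    B (wedge V (v i) (v j)) (wedge V (v k) (v l)), pluecker]
  rw [h 1 0, h 2 0, h 3 0, h 2 1, h 3 1, h 3 2]
  simp only [map_neg, LinearMap.neg_apply, neg_neg]
  rw [hB (wedge V (v 2) (v 3)) (wedge V (v 0) (v 1)),
    hB (wedge V (v 1) (v 3)) (wedge V (v 0) (v 2)),
    hB (wedge V (v 1) (v 2)) (wedge V (v 0) (v 3))]
  module

/-- The projection-and-multiplication map `⨂⁴ V → Sym²(⋀² V)`. -/
abbrev wedgeMul (V : Type) [AddCommGroup V] [Module ℂ V] :
    (⨂[ℂ]^(2 + 2) V) →ₗ[ℂ] SymmAlgebra (Wedge2 V) :=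
  mulTwo V 2 _ (ιSym _ ∘ₗ toWedge2 V)

theorem wedgeMul_tprod (v : Fin 4 → V) :
    wedgeMul V (tprod ℂ v) = symMul _ (wedge V (v 0) (v 1)) (wedge V (v 2) (v 3)) := by
  refine (mulTwo_tprod 2 _ v).trans ?_
  rw [LinearMap.comp_apply, LinearMap.comp_apply, toWedge2_tprod, toWedge2_tprod]
  rfl

theorem wedgeMul_blockSym (v : Fin 4 → V) :
    wedgeMul V (blockSym V 4 [(4, true)] (tprod ℂ v)) =
      (8 : ℂ) • pluecker (symMul _) (v 0) (v 1) (v 2) (v 3) := by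
  simp only [blockSym_true_tprod, map_sum, map_smul, wedgeMul_tprod]
  exact sum_sign_perm_wedge (symMul _) symMul_comm v

theorem pluecker_mem_U₃ (a b c d : V) : pluecker (symMul _) a b c d ∈ U₃ V := by
  have h : wedgeMul V (blockSym V 4 [(4, true)] (tprod ℂ ![a, b, c, d])) ∈ U₃ V :=
    Submodule.mem_map_of_mem (LinearMap.mem_range_self _ _)
  rw [wedgeMul_blockSym] at h
  exact (Submodule.smul_mem_iff _ (by norm_num : (8 : ℂ) ≠ 0)).1 h

theorem U₃_le (S : Submodule ℂ (SymmAlgebra (Wedge2 V)))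
    (h : ∀ a b c d, pluecker (symMul _) a b c d ∈ S) : U₃ V ≤ S := by
  rintro _ ⟨_, ⟨x, rfl⟩, rfl⟩
  refine tensorPower_le_comap (wedgeMul V ∘ₗ blockSym V 4 [(4, true)]) S (fun v => ?_) x
  rw [LinearMap.comp_apply, wedgeMul_blockSym]
  exact S.smul_mem _ (h _ _ _ _)

theorem permAct_map {V' : Type} [AddCommGroup V'] [Module ℂ V'] (g : V →ₗ[ℂ] V') (n : ℕ)
    (σ : Equiv.Perm (Fin n)) (x : ⨂[ℂ]^n V) :
    PiTensorProduct.map (fun _ => g) (permAct V n σ x) =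
      permAct V' n σ (PiTensorProduct.map (fun _ => g) x) := by
  suffices (PiTensorProduct.map (fun _ => g)) ∘ₗ permAct V n σ =
      permAct V' n σ ∘ₗ PiTensorProduct.map (fun _ => g) from LinearMap.congr_fun this x
  apply PiTensorProduct.ext
  ext v
  simp

theorem blockSym_map {V' : Type} [AddCommGroup V'] [Module ℂ V'] (g : V →ₗ[ℂ] V') (n : ℕ)
    (l : List (ℕ × Bool)) (x : ⨂[ℂ]^n V) :
    PiTensorProduct.map (fun _ => g) (blockSym V n l x) =
      blockSym V' n l (PiTensorProduct.map (fun _ => g) x) := by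
  simp only [blockSym, LinearMap.comp_apply, LinearMap.sum_apply, LinearMap.smul_apply, map_sum,
    map_smul, permAct_map]

/-- The isomorphism of exterior squares induced by a linear equivalence. -/
def wedge2Congr {V' : Type} [AddCommGroup V'] [Module ℂ V'] (g : V ≃ₗ[ℂ] V') :
    Wedge2 V ≃ₗ[ℂ] Wedge2 V' :=
  LinearEquiv.ofSubmodules (PiTensorProduct.congr fun _ => g) _ _ (by
    apply le_antisymm
    · rintro _ ⟨_, ⟨x, rfl⟩, rfl⟩
      exact ⟨_, (blockSym_map g.toLinearMap 2 _ x).symm⟩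
    · rintro _ ⟨x, rfl⟩
      obtain ⟨y, rfl⟩ := (PiTensorProduct.congr fun _ : Fin 2 => g).surjective x
      exact ⟨_, LinearMap.mem_range_self _ y, blockSym_map g.toLinearMap 2 _ y⟩)

theorem wedge2Congr_wedge {V' : Type} [AddCommGroup V'] [Module ℂ V'] (g : V ≃ₗ[ℂ] V') (a b : V) :
    wedge2Congr g (wedge V a b) = wedge V' (g a) (g b) := by
  have h : ∀ a b, PiTensorProduct.congr (fun _ : Fin 2 => g) (tprodPair V a b) =
      tprodPair V' (g a) (g b) := fun a b => by
    simp only [tprodPair_apply, congr_tprod]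
    congr 1
    ext i
    fin_cases i <;> rfl
  ext
  simp [wedge2Congr, coe_wedge, h]

theorem U₃_map {V' : Type} [AddCommGroup V'] [Module ℂ V'] (g : V ≃ₗ[ℂ] V') :
    (U₃ V).map (symCongr (wedge2Congr g)).toLinearMap = U₃ V' := by
  have h : ∀ a b c d, (symCongr (wedge2Congr g)).toLinearMap (pluecker (symMul _) a b c d) =
      pluecker (symMul _) (g a) (g b) (g c) (g d) := fun a b c d => by
    simp only [pluecker, map_add, map_sub, AlgEquiv.toLinearMap_apply, symCongr_symMul,
      wedge2Congr_wedge]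
  apply le_antisymm
  · rw [Submodule.map_le_iff_le_comap]
    apply U₃_le
    intro a b c d
    rw [Submodule.mem_comap, h]
    exact pluecker_mem_U₃ _ _ _ _
  · apply U₃_le
    intro a b c d
    refine ⟨_, pluecker_mem_U₃ (g.symm a) (g.symm b) (g.symm c) (g.symm d), ?_⟩
    simp [h]

end Pluecker

/-! ### Young symmetrizers -/

section Young

variable {W : Type} [AddCommGroup W] [Module ℂ W]

/-- The signed sum of the permutations of the tensor factors which preserve `c`. -/
def colAlt (W : Type) [AddCommGroup W] [Module ℂ W] (n : ℕ) (c : Fin n → ℕ) :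
    (⨂[ℂ]^n W) →ₗ[ℂ] ⨂[ℂ]^n W :=
  ∑ σ : Equiv.Perm (Fin n) with ∀ k, c (σ k) = c k,
    ((Equiv.Perm.sign σ : ℤ) : ℂ) • permAct W n σ

/-- The sum of the permutations of the tensor factors which preserve `r`. -/
def rowSym (W : Type) [AddCommGroup W] [Module ℂ W] (n : ℕ) (r : Fin n → ℕ) :
    (⨂[ℂ]^n W) →ₗ[ℂ] ⨂[ℂ]^n W :=
  ∑ τ : Equiv.Perm (Fin n) with ∀ k, r (τ k) = r k, permAct W n τ

theorem youngSymmetrizer_eq (n : ℕ) (l : List ℕ) :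
    youngSymmetrizer W n l =
      colAlt W n (fun k => colIdx l k) ∘ₗ rowSym W n (fun k => rowIdx l k) := by
  ext v
  simp only [youngSymmetrizer, colAlt, rowSym, LinearMap.compMultilinearMap_apply,
    LinearMap.sum_apply, LinearMap.comp_apply, Finset.sum_filter]
  refine Finset.sum_congr rfl fun σ _ => ?_
  by_cases hσ : ∀ k : Fin n, colIdx l (σ k) = colIdx l k
  · rw [if_pos hσ, map_sum]
    refine Finset.sum_congr rfl fun τ _ => ?_
    by_cases hτ : ∀ k : Fin n, rowIdx l (τ k) = rowIdx l k
    · rw [if_pos ⟨hσ, hτ⟩, if_pos hτ]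
      rfl
    · rw [if_neg fun h => hτ h.2, if_neg hτ, zero_smul, LinearMap.zero_apply]
      exact (map_zero _).symm
  · rw [if_neg hσ, LinearMap.zero_apply]
    refine Finset.sum_eq_zero fun τ _ => ?_
    rw [if_neg fun h => hσ h.1, zero_smul, LinearMap.zero_apply]

theorem rowSym_tprod (n : ℕ) (r : Fin n → ℕ) (v : Fin n → W) :
    rowSym W n r (tprod ℂ v) =
      ∑ τ : Equiv.Perm (Fin n) with ∀ k, r (τ k) = r k, tprod ℂ (fun i => v (τ i)) := by
  simp only [rowSym, LinearMap.sum_apply, permAct_tprod]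
  refine Finset.sum_nbij' (·⁻¹) (·⁻¹) ?_ ?_ ?_ ?_ ?_
  · intro τ
    simp only [Finset.mem_filter, Finset.mem_univ, true_and]
    intro h k
    simpa using (h (τ⁻¹ k)).symm
  · intro τ
    simp only [Finset.mem_filter, Finset.mem_univ, true_and]
    intro h k
    simpa using (h (τ⁻¹ k)).symm
  · simp
  · simp
  · intro τ _
    rfl

theorem colAlt_tprod (n : ℕ) (c : Fin n → ℕ) (v : Fin n → W) :
    colAlt W n c (tprod ℂ v) =
      ∑ σ : Equiv.Perm (Fin n) with ∀ k, c (σ k) = c k,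
        ((Equiv.Perm.sign σ : ℤ) : ℂ) • tprod ℂ (fun i => v (σ i)) := by
  simp only [colAlt, LinearMap.sum_apply, LinearMap.smul_apply, permAct_tprod]
  refine Finset.sum_nbij' (·⁻¹) (·⁻¹) ?_ ?_ ?_ ?_ ?_
  · intro τ
    simp only [Finset.mem_filter, Finset.mem_univ, true_and]
    intro h k
    simpa using (h (τ⁻¹ k)).symm
  · intro τ
    simp only [Finset.mem_filter, Finset.mem_univ, true_and]
    intro h k
    simpa using (h (τ⁻¹ k)).symm
  · simp
  · simp
  · intro τ _
    simp only [Equiv.Perm.sign_inv]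
    rfl

theorem rowSym_three_one_tprod (v : Fin 4 → W) :
    rowSym W 4 (fun k => rowIdx [3, 1, 0] k) (tprod ℂ v) =
      tprod ℂ ![v 0, v 1, v 2, v 3] + tprod ℂ ![v 1, v 0, v 2, v 3] +
      tprod ℂ ![v 2, v 1, v 0, v 3] + tprod ℂ ![v 0, v 2, v 1, v 3] +
      tprod ℂ ![v 1, v 2, v 0, v 3] + tprod ℂ ![v 2, v 0, v 1, v 3] := by
  have h : (Finset.univ.filter fun τ : Equiv.Perm (Fin 4) =>
      ∀ k : Fin 4, rowIdx [3, 1, 0] (τ k) = rowIdx [3, 1, 0] k) =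
      {1, Equiv.swap 0 1, Equiv.swap 0 2, Equiv.swap 1 2, Equiv.swap 0 1 * Equiv.swap 1 2,
        Equiv.swap 1 2 * Equiv.swap 0 1} := by decide
  have e : ∀ τ : Equiv.Perm (Fin 4),
      (fun i => v (τ i)) = ![v (τ 0), v (τ 1), v (τ 2), v (τ 3)] := fun τ => by
    ext i
    fin_cases i <;> rfl
  rw [rowSym_tprod, h]
  simp only [e]
  rw [Finset.sum_insert (by decide), Finset.sum_insert (by decide), Finset.sum_insert (by decide),
    Finset.sum_insert (by decide), Finset.sum_pair (by decide)]
  simp only [← add_assoc]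
  rfl

theorem colAlt_three_one_tprod (v : Fin 4 → W) :
    colAlt W 4 (fun k => colIdx [3, 1, 0] k) (tprod ℂ v) =
      tprod ℂ ![v 0, v 1, v 2, v 3] - tprod ℂ ![v 3, v 1, v 2, v 0] := by
  have h : (Finset.univ.filter fun τ : Equiv.Perm (Fin 4) =>
      ∀ k : Fin 4, colIdx [3, 1, 0] (τ k) = colIdx [3, 1, 0] k) =
      {1, Equiv.swap 0 3} := by decide
  have e : ∀ τ : Equiv.Perm (Fin 4),
      (fun i => v (τ i)) = ![v (τ 0), v (τ 1), v (τ 2), v (τ 3)] := fun τ => by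
    ext i
    fin_cases i <;> rfl
  rw [colAlt_tprod, h]
  simp only [e]
  rw [Finset.sum_pair (by decide), sub_eq_add_neg, Equiv.Perm.sign_swap (by decide)]
  simp
  rfl

end Young

/-! ### Symmetric squares and the isomorphism `S_{(3,1)} W ≅ ⋀²(Sym² W)` -/

section SymSquare

variable {W : Type} [AddCommGroup W] [Module ℂ W]

/-- The canonical projection `⨂² W → Sym² W`. -/
abbrev toSym2 (W : Type) [AddCommGroup W] [Module ℂ W] : (⨂[ℂ]^2 W) →ₗ[ℂ] Sym2Sub W :=
  (blockSym W 2 [(2, false)]).rangeRestrict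

/-- The commutative product `W × W → Sym² W`. -/
def symProd (W : Type) [AddCommGroup W] [Module ℂ W] : W →ₗ[ℂ] W →ₗ[ℂ] Sym2Sub W :=
  (tprodPair W).compr₂ (toSym2 W)

theorem coe_symProd (a b : W) : (symProd W a b : ⨂[ℂ]^2 W) = tprodPair W a b + tprodPair W b a := by
  change blockSym W 2 [(2, false)] (tprod ℂ ![a, b]) = _
  have h : (Finset.univ : Finset (Equiv.Perm (Fin 2))) = {1, Equiv.swap 0 1} := by decide
  rw [blockSym_false_tprod, h, Finset.sum_pair (by decide)]
  simp only [tprod_two]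
  simp

theorem symProd_comm (a b : W) : symProd W a b = symProd W b a := by
  ext
  simp [coe_symProd, add_comm]

theorem toSym2_tprod (v : Fin 2 → W) : toSym2 W (tprod ℂ v) = symProd W (v 0) (v 1) := by
  rw [tprod_two]
  rfl

theorem sym2_hom_ext {X : Type} [AddCommGroup X] [Module ℂ X] {f g : Sym2Sub W →ₗ[ℂ] X}
    (h : ∀ a b, f (symProd W a b) = g (symProd W a b)) : f = g := by
  apply (LinearMap.cancel_right (LinearMap.surjective_rangeRestrict _)).1
  apply PiTensorProduct.ext
  ext v
  exact (congrArg f (toSym2_tprod v)).trans ((h _ _).trans (congrArg g (toSym2_tprod v)).symm)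

/-- The element `ab ∧ cd` of `⋀²(Sym² W)`. -/
def quad (a b c d : W) : Wedge2 (Sym2Sub W) := wedge _ (symProd W a b) (symProd W c d)

theorem quad_swap_left (a b c d : W) : quad a b c d = quad b a c d :=
  congrArg (fun s => wedge _ s (symProd W c d)) (symProd_comm a b)

theorem quad_swap_right (a b c d : W) : quad a b c d = quad a b d c :=
  congrArg (wedge _ (symProd W a b)) (symProd_comm c d)

theorem quad_swap (a b c d : W) : quad a b c d = -quad c d a b := wedge_swap _ _

theorem quad_reverse (a b c d : W) : quad a b c d = -quad d c b a := by
  rw [quad_swap, quad_swap_left, quad_swap_right]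

theorem quad_self (a b : W) : quad a b a b = 0 := wedge_self _

/-- The image `ab ∧ cd + ac ∧ bd + bc ∧ ad` of `a ⊗ b ⊗ c ⊗ d` under the projection onto the
summand `S_{(3,1)} W`, up to a scalar. -/
def cubic (a b c d : W) : Wedge2 (Sym2Sub W) := quad a b c d + quad a c b d + quad b c a d

theorem wedge2_sym2_hom_ext {X : Type} [AddCommGroup X] [Module ℂ X]
    {f g : Wedge2 (Sym2Sub W) →ₗ[ℂ] X}
    (h : ∀ a b c d, f (quad a b c d) = g (quad a b c d)) :
    f = g := by
  have : (wedge (Sym2Sub W)).compr₂ f = (wedge (Sym2Sub W)).compr₂ g :=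
    sym2_hom_ext fun a b => sym2_hom_ext fun c d => h a b c d
  exact wedge2_hom_ext fun s t => LinearMap.congr_fun₂ this s t

/-- The linear map on `⨂² V` determined by a bilinear map. -/
def liftPair {V X : Type} [AddCommGroup V] [Module ℂ V] [AddCommGroup X] [Module ℂ X]
    (B : V →ₗ[ℂ] V →ₗ[ℂ] X) : (⨂[ℂ]^2 V) →ₗ[ℂ] X :=
  PiTensorProduct.lift
    { toFun := fun v => B (v 0) (v 1)
      map_update_add' := fun v i x y => by fin_cases i <;> simp
      map_update_smul' := fun v i x y => by fin_cases i <;> simp }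

theorem liftPair_tprodPair {V X : Type} [AddCommGroup V] [Module ℂ V] [AddCommGroup X]
    [Module ℂ X] (B : V →ₗ[ℂ] V →ₗ[ℂ] X) (a b : V) : liftPair B (tprodPair V a b) = B a b := by
  simp [liftPair, tprodPair_apply]

/-- The canonical projection `⨂⁴ W → S_{(3,1)} W`. -/
def toSchur (W : Type) [AddCommGroup W] [Module ℂ W] :
    (⨂[ℂ]^4 W) →ₗ[ℂ] SchurModule W 4 [3, 1, 0] :=
  (youngSymmetrizer W 4 [3, 1, 0]).rangeRestrict

theorem toSchur_surjective : Function.Surjective (toSchur W) :=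
  LinearMap.surjective_rangeRestrict _

/-- The image in `S_{(3,1)} W` of the tensor `a ⊗ b ⊗ c ⊗ d`. -/
def schur (a b c d : W) : SchurModule W 4 [3, 1, 0] :=
  toSchur W (tprod ℂ ![a, b, c, d])

theorem toSchur_tprod (v : Fin 4 → W) :
    toSchur W (tprod ℂ v) = schur (v 0) (v 1) (v 2) (v 3) := by
  have hv : ![v 0, v 1, v 2, v 3] = v := by
    ext i
    fin_cases i <;> rfl
  rw [schur, hv]

theorem schur_hom_ext {X : Type} [AddCommGroup X] [Module ℂ X]
    {f g : SchurModule W 4 [3, 1, 0] →ₗ[ℂ] X}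
    (h : ∀ a b c d : W, f (schur a b c d) = g (schur a b c d)) : f = g := by
  apply (LinearMap.cancel_right toSchur_surjective).1
  apply PiTensorProduct.ext
  ext v
  simp only [LinearMap.compMultilinearMap_apply, LinearMap.comp_apply, toSchur_tprod, h]

theorem coe_schur (a b c d : W) : (schur a b c d : ⨂[ℂ]^4 W) =
    (tprod ℂ ![a, b, c, d] - tprod ℂ ![d, b, c, a]) +
    (tprod ℂ ![b, a, c, d] - tprod ℂ ![d, a, c, b]) +
    (tprod ℂ ![c, b, a, d] - tprod ℂ ![d, b, a, c]) +
    (tprod ℂ ![a, c, b, d] - tprod ℂ ![d, c, b, a]) +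
    (tprod ℂ ![b, c, a, d] - tprod ℂ ![d, c, a, b]) +
    (tprod ℂ ![c, a, b, d] - tprod ℂ ![d, a, b, c]) := by
  change youngSymmetrizer W 4 [3, 1, 0] (tprod ℂ ![a, b, c, d]) = _
  rw [youngSymmetrizer_eq, LinearMap.comp_apply, rowSym_three_one_tprod]
  simp only [map_add, colAlt_three_one_tprod]
  rfl

theorem schur_swap_left (a b c d : W) : schur a b c d = schur b a c d := by
  ext
  rw [coe_schur, coe_schur]
  abel

theorem schur_swap_right (a b c d : W) : schur a b c d = schur a c b d := by
  ext
  rw [coe_schur, coe_schur]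
  abel

theorem schur_relation (a b c d : W) :
    schur a b c d + schur a b d c + schur a c d b + schur b c d a = 0 := by
  ext
  simp only [Submodule.coe_add, coe_schur]
  rw [Submodule.coe_zero]
  abel

/-- The map `⨂⁴ W → ⋀²(Sym² W)` sending `a ⊗ b ⊗ c ⊗ d` to `ab ∧ cd`. -/
def symProdWedge (W : Type) [AddCommGroup W] [Module ℂ W] :
    (⨂[ℂ]^4 W) →ₗ[ℂ] Wedge2 (Sym2Sub W) :=
  TensorProduct.lift (((wedge (Sym2Sub W)).comp (toSym2 W)).compl₂ (toSym2 W)) ∘ₗ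
    (tensorPowMul W 2 2).symm.toLinearMap

theorem symProdWedge_tprod (v : Fin 4 → W) :
    symProdWedge W (tprod ℂ v) = quad (v 0) (v 1) (v 2) (v 3) := by
  refine (congrArg (TensorProduct.lift (((wedge (Sym2Sub W)).comp (toSym2 W)).compl₂ (toSym2 W)))
    (tensorPowMul_symm_tprod 2 2 v)).trans ?_
  rw [TensorProduct.lift.tmul, LinearMap.compl₂_apply, LinearMap.comp_apply, toSym2_tprod,
    toSym2_tprod]
  rfl

/-- The map `S_{(3,1)} W → ⋀²(Sym² W)`. -/
def schurToWedge (W : Type) [AddCommGroup W] [Module ℂ W] :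
    SchurModule W 4 [3, 1, 0] →ₗ[ℂ] Wedge2 (Sym2Sub W) :=
  symProdWedge W ∘ₗ (SchurModule W 4 [3, 1, 0]).subtype

theorem schurToWedge_schur (a b c d : W) : schurToWedge W (schur a b c d) =
    (4 : ℂ) • cubic a b c d := by
  rw [schurToWedge, LinearMap.comp_apply, Submodule.subtype_apply, coe_schur, cubic]
  simp only [map_add, map_sub, symProdWedge_tprod]
  simp only [Matrix.cons_val]
  rw [quad_reverse d b c a, quad_reverse d a c b, quad_reverse d b a c, quad_reverse d c b a,
    quad_reverse d c a b, quad_reverse d a b c, quad_swap_left b a c d, quad_swap_left c b a d,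
    quad_swap_left c a b d]
  module

/-- The multiplication `⨂² W × ⨂² W → ⨂⁴ W`. -/
def tensorMul (W : Type) [AddCommGroup W] [Module ℂ W] :
    (⨂[ℂ]^2 W) →ₗ[ℂ] (⨂[ℂ]^2 W) →ₗ[ℂ] ⨂[ℂ]^4 W :=
  (TensorProduct.mk ℂ (⨂[ℂ]^2 W) (⨂[ℂ]^2 W)).compr₂ (tensorPowMul W 2 2).toLinearMap

theorem tensorMul_tprodPair (a b c d : W) :
    tensorMul W (tprodPair W a b) (tprodPair W c d) = tprod ℂ ![a, b, c, d] := by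
  refine Eq.trans ?_ (tensorPowMul_tmul_tprod 2 2 ![a, b, c, d])
  rw [tprod_two, tprod_two]
  rfl

/-- The map `⋀²(Sym² W) → S_{(3,1)} W`. -/
def wedgeToSchur (W : Type) [AddCommGroup W] [Module ℂ W] :
    Wedge2 (Sym2Sub W) →ₗ[ℂ] SchurModule W 4 [3, 1, 0] :=
  toSchur W ∘ₗ liftPair ((tensorMul W).compl₁₂ (Sym2Sub W).subtype (Sym2Sub W).subtype) ∘ₗ
    (Wedge2 (Sym2Sub W)).subtype

theorem wedgeToSchur_wedge (a b c d : W) : wedgeToSchur W (quad a b c d) =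
    (4 : ℂ) • (schur a b c d + schur a b d c) := by
  have h₀ : ∀ a b c d : W, toSchur W (tprod ℂ ![a, b, c, d]) = schur a b c d :=
    fun _ _ _ _ => rfl
  have h₁ := schur_swap_left (W := W)
  have h₂ := schur_swap_right (W := W)
  have h₃ : schur b c d a = -(schur a b c d + schur a b d c + schur a c d b) := by
    rw [eq_neg_iff_add_eq_zero, add_comm, schur_relation]
  simp only [wedgeToSchur, quad, LinearMap.comp_apply, Submodule.subtype_apply, coe_wedge, map_sub,
    liftPair_tprodPair, LinearMap.compl₁₂_apply, coe_symProd, map_add, LinearMap.add_apply,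
    tensorMul_tprodPair, h₀]
  rw [h₁ b a c d, h₁ b a d c, h₁ d c a b, h₁ d c b a, h₂ c d a b, h₁ c a d b, h₂ c d b a,
    h₁ c b d a, h₃]
  module

/-- The isomorphism `S_{(3,1)} W ≅ ⋀²(Sym² W)`. -/
def schurEquiv (W : Type) [AddCommGroup W] [Module ℂ W] :
    SchurModule W 4 [3, 1, 0] ≃ₗ[ℂ] Wedge2 (Sym2Sub W) :=
  LinearEquiv.ofLinearMap (schurToWedge W) ((32⁻¹ : ℂ) • wedgeToSchur W)
    (wedge2_sym2_hom_ext fun a b c d => by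
      simp only [LinearMap.comp_apply, LinearMap.smul_apply, map_smul, wedgeToSchur_wedge,
        map_add, schurToWedge_schur, cubic, LinearMap.id_apply]
      rw [quad_swap_right a b d c, quad_swap a d b c, quad_swap b d a c]
      module)
    (schur_hom_ext fun a b c d => by
      have h : schur b c d a = -(schur a b c d + schur a b d c + schur a c d b) := by
        rw [eq_neg_iff_add_eq_zero, add_comm, schur_relation]
      simp only [LinearMap.comp_apply, LinearMap.smul_apply, map_smul, wedgeToSchur_wedge,
        map_add, schurToWedge_schur, cubic, LinearMap.id_apply]
      rw [schur_swap_right a c b d, schur_swap_right b c a d, schur_swap_left b a c d, h]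
      module)

theorem schurEquiv_schur (a b c d : W) : schurEquiv W (schur a b c d) =
    (4 : ℂ) • cubic a b c d :=
  schurToWedge_schur a b c d

end SymSquare

section Core

variable {W : Type} [AddCommGroup W] [Module ℂ W]

theorem sum_cubic_mul_cubic {X : Type} [AddCommGroup X] [Module ℂ X]
    (B : Wedge2 (Sym2Sub W) →ₗ[ℂ] Wedge2 (Sym2Sub W) →ₗ[ℂ] X) (hB : ∀ s t, B s t = B t s)
    (f : W → W → W → X) (x y z : W)
    (hf : ∀ p q r, f p q r = B (cubic p x x x) (cubic q y y r) -
      B (cubic p x y x) (cubic q y x r) - B (cubic p y x x) (cubic q x y r) +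
      B (cubic p y y x) (cubic q x x r)) :
    f x y z - f y x z - f x z y - f z y x + f y z x + f z x y =
      (-8 : ℂ) • pluecker B (symProd W x x) (symProd W x y) (symProd W x z) (symProd W y y) := by
  have h : pluecker B (symProd W x x) (symProd W x y) (symProd W x z) (symProd W y y) =
      B (quad x x x y) (quad x z y y) - B (quad x x x z) (quad x y y y) +
        B (quad x x y y) (quad x y x z) := rfl
  rw [h]
  have l₁ := quad_swap_left y x
  have l₂ := quad_swap_left z x
  have l₃ := quad_swap_left z y
  have r₁ := fun a b => quad_swap_right a b y x
  have r₂ := fun a b => quad_swap_right a b z x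
  have r₃ := fun a b => quad_swap_right a b z y
  simp only [hf, cubic, l₁, l₂, l₃, r₁, r₂, r₃]
  simp only [quad_self, quad_swap x y x x, quad_swap x z x x, quad_swap y y x x, quad_swap y z x x,
    quad_swap x z x y, quad_swap y y x y, quad_swap y z x y,
    quad_swap y y x z, quad_swap y z y y,
    map_add, map_neg, map_zero, LinearMap.add_apply, LinearMap.neg_apply,
    LinearMap.zero_apply]
  simp only [hB (quad x y y y) (quad x x x z), hB (quad x x y z) (quad x x y y),
    hB (quad x y x z) (quad x x y y), hB (quad x y y z) (quad x x x y),
    hB (quad x z y y) (quad x x x y)]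
  module

end Core

section Columns

theorem sum_perm_preserving {X : Type} [AddCommMonoid X] {n : ℕ} (c c' : Fin n → ℕ) (k : Fin n)
    (h : ∀ i j, c' i = c' j ↔ i = j ∨ (c i = c j ∧ i ≠ k ∧ j ≠ k))
    (f : Equiv.Perm (Fin n) → X) :
    ∑ σ : Equiv.Perm (Fin n) with ∀ i, c (σ i) = c i, f σ =
      ∑ j with c j = c k, ∑ σ : Equiv.Perm (Fin n) with ∀ i, c' (σ i) = c' i,
        f (Equiv.swap k j * σ) := by
  rw [← Finset.sum_product']
  refine Finset.sum_nbij' (fun σ => (σ k, Equiv.swap k (σ k) * σ)) (fun p => Equiv.swap k p.1 * p.2)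
    ?_ ?_ ?_ ?_ ?_
  · intro σ
    simp only [Finset.mem_product, Finset.mem_filter, Finset.mem_univ, true_and, h,
      Equiv.Perm.mul_apply]
    refine fun hσ => ⟨hσ k, fun i => ?_⟩
    by_cases hi : i = k
    · left
      rw [hi, Equiv.swap_apply_right]
    right
    have hi' : σ i ≠ σ k := fun e => hi (σ.injective e)
    by_cases hk : σ i = k
    · rw [hk, Equiv.swap_apply_left]
      refine ⟨?_, fun e => hi' (hk.trans e.symm), hi⟩
      rw [hσ k, ← hσ i, hk]
    · rw [Equiv.swap_apply_of_ne_of_ne hk hi']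
      exact ⟨hσ i, hk, hi⟩
  · rintro ⟨j, σ⟩
    simp only [Finset.mem_product, Finset.mem_filter, Finset.mem_univ, true_and, h,
      Equiv.Perm.mul_apply]
    rintro ⟨hj, hσ⟩ i
    have hs : ∀ x, c (Equiv.swap k j x) = c x := fun x => by
      rw [Equiv.swap_apply_def]
      split_ifs with h₁ h₂
      · rw [h₁, hj]
      · rw [h₂, hj]
      · rfl
    rw [hs]
    rcases hσ i with e | e
    · rw [e]
    · exact e.1
  · intro σ _
    simp [← mul_assoc]
  · rintro ⟨j, σ⟩
    simp only [Finset.mem_product, Finset.mem_filter, Finset.mem_univ, true_and, h]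
    rintro ⟨_, hσ⟩
    have hk : σ k = k := by simpa using hσ k
    simp [hk, ← mul_assoc]
  · intro σ _
    simp [← mul_assoc]

theorem sum_sign_perm_columns {X : Type} [AddCommGroup X] [Module ℂ X]
    (f : Fin 8 → Fin 8 → Fin 8 → Fin 8 → Fin 8 → Fin 8 → Fin 8 → Fin 8 → X)
    (g : Fin 8 → Fin 8 → Fin 8 → X)
    (hg : ∀ p q r, g p q r = f p 1 2 3 q 5 6 r - f p 1 6 3 q 5 2 r - f p 5 2 3 q 1 6 r +
      f p 5 6 3 q 1 2 r) :
    ∑ σ : Equiv.Perm (Fin 8) with ∀ k : Fin 8, colIdx [4, 3, 1] (σ k) = colIdx [4, 3, 1] k,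
      ((Equiv.Perm.sign σ : ℤ) : ℂ) • f (σ 0) (σ 1) (σ 2) (σ 3) (σ 4) (σ 5) (σ 6) (σ 7) =
      g 0 4 7 - g 4 0 7 - g 0 7 4 - g 7 4 0 + g 4 7 0 + g 7 0 4 := by
  have hj₀ : (Finset.univ.filter fun j : Fin 8 => colIdx [4, 3, 1] j = colIdx [4, 3, 1] (0 : Fin 8)) =
      {0, 4, 7} := by decide
  have hj₁ : (Finset.univ.filter fun j => ![8, 1, 2, 3, 0, 1, 2, 0] j =
      ![8, 1, 2, 3, 0, 1, 2, 0] (4 : Fin 8)) = {4, 7} := by decide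
  have hj₂ : (Finset.univ.filter fun j => ![8, 1, 2, 3, 9, 1, 2, 0] j =
      ![8, 1, 2, 3, 9, 1, 2, 0] (1 : Fin 8)) = {1, 5} := by decide
  have hj₃ : (Finset.univ.filter fun j => ![8, 10, 2, 3, 9, 1, 2, 0] j =
      ![8, 10, 2, 3, 9, 1, 2, 0] (2 : Fin 8)) = {2, 6} := by decide
  have h₁ : (Finset.univ.filter fun σ : Equiv.Perm (Fin 8) => ∀ i,
      ![8, 10, 11, 3, 9, 1, 2, 0] (σ i) = ![8, 10, 11, 3, 9, 1, 2, 0] i) = {1} := by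
    have hinj : Function.Injective ![8, 10, 11, 3, 9, 1, 2, 0] := by decide
    ext σ
    simp [hinj.eq_iff, Equiv.ext_iff]
  rw [sum_perm_preserving (fun k : Fin 8 => colIdx [4, 3, 1] k) ![8, 1, 2, 3, 0, 1, 2, 0] 0
    (by decide), hj₀]
  simp only [sum_perm_preserving ![8, 1, 2, 3, 0, 1, 2, 0] ![8, 1, 2, 3, 9, 1, 2, 0] 4 (by decide),
    sum_perm_preserving ![8, 1, 2, 3, 9, 1, 2, 0] ![8, 10, 2, 3, 9, 1, 2, 0] 1 (by decide),
    sum_perm_preserving ![8, 10, 2, 3, 9, 1, 2, 0] ![8, 10, 11, 3, 9, 1, 2, 0] 2 (by decide),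
    h₁, hj₁, hj₂, hj₃, Finset.sum_singleton]
  rw [Finset.sum_insert (by decide), Finset.sum_pair (by decide)]
  simp only [Finset.sum_pair (by decide : (4 : Fin 8) ≠ 7),
    Finset.sum_pair (by decide : (1 : Fin 8) ≠ 5), Finset.sum_pair (by decide : (2 : Fin 8) ≠ 6),
    Equiv.Perm.sign_mul, Equiv.Perm.sign_swap', Equiv.Perm.sign_one, hg, Equiv.Perm.mul_apply,
    Equiv.Perm.one_apply, Equiv.swap_apply_def]
  simp
  module

end Columns

section Polarization

variable {W : Type} [AddCommGroup W] [Module ℂ W]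

theorem sum_neg_one_pow_card_forall_mem {n : ℕ} (φ : Fin n → Fin n) :
    (∑ S : Finset (Fin n), if ∀ k, φ k ∈ S then (-1 : ℂ) ^ S.card else 0) =
      if Function.Bijective φ then (-1) ^ n else 0 := by
  split_ifs with h
  · rw [Finset.sum_eq_single Finset.univ]
    · simp
    · intro S _ hS
      rw [if_neg]
      refine fun hk => hS (Finset.eq_univ_of_forall fun j => ?_)
      obtain ⟨k, rfl⟩ := h.2 j
      exact hk k
    · simp
  · have hs : ¬ Function.Surjective φ := fun hs => h (Finite.surjective_iff_bijective.1 hs)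
    obtain ⟨j, hj⟩ := not_forall.1 hs
    have hjk : ∀ k, φ k ≠ j := fun k hk => hj ⟨k, hk⟩
    refine Finset.sum_involution (fun S _ => if j ∈ S then S.erase j else insert j S) ?_ ?_ ?_ ?_
    · intro S _
      by_cases hS : j ∈ S
      · rw [if_pos hS]
        have := Finset.card_erase_add_one hS
        simp only [Finset.mem_erase, ne_eq, hjk, not_false_eq_true, true_and]
        rw [← this]
        split_ifs <;> ring
      · rw [if_neg hS]
        simp only [Finset.mem_insert, hjk, false_or, Finset.card_insert_of_notMem hS]
        split_ifs <;> ring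
    · intro S _ _
      by_cases hS : j ∈ S
      · rw [if_pos hS]
        exact Finset.erase_ne_self.2 hS
      · rw [if_neg hS]
        exact Finset.insert_ne_self.2 hS
    · intro S _
      exact Finset.mem_univ _
    · intro S _
      by_cases hS : j ∈ S
      · simp [hS]
      · simp [hS]

theorem sum_sign_tprod_eq_rowSym (n : ℕ) (r : Fin n → ℕ) (v : Fin n → W) :
    (∑ S : Finset (Fin n), (-1 : ℂ) ^ S.card • tprod ℂ fun k => ∑ j ∈ S with r j = r k, v j) =
      (-1 : ℂ) ^ n • rowSym W n r (tprod ℂ v) := by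
  have h₁ : ∀ S : Finset (Fin n), (tprod ℂ fun k => ∑ j ∈ S with r j = r k, v j) =
      ∑ φ : Fin n → Fin n with ∀ k, r (φ k) = r k,
        if ∀ k, φ k ∈ S then tprod ℂ fun k => v (φ k) else 0 := fun S => by
    rw [MultilinearMap.map_sum_finset (tprod ℂ) fun _ j => v j, ← Finset.sum_filter]
    refine Finset.sum_congr ?_ fun _ _ => rfl
    ext φ
    simp only [Fintype.mem_piFinset, Finset.mem_filter, Finset.mem_univ, true_and, forall_and,
      and_comm]
  simp only [h₁, Finset.smul_sum]
  rw [Finset.sum_comm, rowSym_tprod, Finset.smul_sum]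
  have h₂ : ∀ φ : Fin n → Fin n, (∑ S : Finset (Fin n), (-1 : ℂ) ^ S.card •
      if ∀ k, φ k ∈ S then tprod ℂ fun k => v (φ k) else 0) =
      (if Function.Bijective φ then (-1) ^ n else 0 : ℂ) • tprod ℂ fun k => v (φ k) := fun φ => by
    rw [← sum_neg_one_pow_card_forall_mem, Finset.sum_smul]
    refine Finset.sum_congr rfl fun S _ => ?_
    split_ifs <;> simp
  simp only [h₂, ite_smul, zero_smul]
  rw [← Finset.sum_filter, Finset.filter_filter]
  symm
  refine Finset.sum_bij (fun σ _ => σ) ?_ ?_ ?_ ?_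
  · intro σ hσ
    exact Finset.mem_filter.2 ⟨Finset.mem_univ _, (Finset.mem_filter.1 hσ).2, σ.bijective⟩
  · intro σ _ τ _ e
    exact DFunLike.coe_injective e
  · intro φ hφ
    simp only [Finset.mem_filter, Finset.mem_univ, true_and] at hφ
    exact ⟨Equiv.ofBijective φ hφ.2, by simpa using hφ.1, rfl⟩
  · intro σ _
    rfl

theorem rowSym_mem_span (n : ℕ) (r : Fin n → ℕ) (x : ⨂[ℂ]^n W) :
    rowSym W n r x ∈ Submodule.span ℂ
      (Set.range fun w : ℕ → W => tprod ℂ fun k => w (r k)) := by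
  refine tensorPower_le_comap _ _ (fun v => ?_) x
  have h : rowSym W n r (tprod ℂ v) = (-1 : ℂ) ^ n • (∑ S : Finset (Fin n),
      (-1 : ℂ) ^ S.card • tprod ℂ fun k => ∑ j ∈ S with r j = r k, v j) := by
    rw [sum_sign_tprod_eq_rowSym, smul_smul, ← mul_pow]
    simp
  rw [h]
  refine Submodule.smul_mem _ _ (Submodule.sum_mem _ fun S _ => Submodule.smul_mem _ _ ?_)
  exact Submodule.subset_span ⟨fun i => ∑ j ∈ S with r j = i, v j, rfl⟩

theorem tprod_mem_range_rowSym (n : ℕ) (r : Fin n → ℕ) (w : ℕ → W) :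
    (tprod ℂ fun k => w (r k)) ∈ LinearMap.range (rowSym W n r) := by
  have h : rowSym W n r (tprod ℂ fun k => w (r k)) =
      ((Finset.univ.filter fun τ : Equiv.Perm (Fin n) => ∀ k, r (τ k) = r k).card : ℂ) •
        tprod ℂ fun k => w (r k) := by
    rw [rowSym_tprod, Nat.cast_smul_eq_nsmul, ← Finset.sum_const]
    refine Finset.sum_congr rfl fun τ hτ => ?_
    simp only [Finset.mem_filter, Finset.mem_univ, true_and] at hτ
    simp only [hτ]
  have h₀ : ((Finset.univ.filter fun τ : Equiv.Perm (Fin n) => ∀ k, r (τ k) = r k).card : ℂ) ≠ 0 :=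
    Nat.cast_ne_zero.2 (Finset.card_ne_zero.2 ⟨1, by simp⟩)
  rw [← Submodule.smul_mem_iff _ h₀, ← h]
  exact LinearMap.mem_range_self _ _

/-- The range of the symmetrizer of the rows is spanned by the tensors which are constant along
the rows. -/
theorem range_rowSym (n : ℕ) (r : Fin n → ℕ) : LinearMap.range (rowSym W n r) =
    Submodule.span ℂ (Set.range fun w : ℕ → W => tprod ℂ fun k => w (r k)) := by
  apply le_antisymm
  · rintro _ ⟨x, rfl⟩
    exact rowSym_mem_span n r x
  · rw [Submodule.span_le]
    rintro _ ⟨w, rfl⟩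
    exact tprod_mem_range_rowSym n r w

end Polarization

/-! ### The relations of Schur functors and of Plücker -/

/-- The Plücker relation in `Sym²(⋀² V) ⊆ Sym^•(⋀² V)`. -/
def symPluecker {V : Type} [AddCommGroup V] [Module ℂ V] (a b c d : V) : SymmAlgebra (Wedge2 V) :=
  pluecker (symMul (Wedge2 V)) a b c d

section SchurRelations

variable {W X : Type} [AddCommGroup W] [Module ℂ W] [AddCommGroup X] [Module ℂ X]

theorem span_range_eq_of_eq_smul {ι : Type} {f g : ι → X} {c : ℂ} (hc : c ≠ 0)
    (h : ∀ i, f i = c • g i) : Submodule.span ℂ (Set.range f) = Submodule.span ℂ (Set.range g) := by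
  apply le_antisymm <;> rw [Submodule.span_le] <;> rintro _ ⟨i, rfl⟩
  · rw [h]
    exact Submodule.smul_mem _ _ (Submodule.subset_span ⟨i, rfl⟩)
  · refine (Submodule.smul_mem_iff _ hc).1 ?_
    rw [← h]
    exact Submodule.subset_span ⟨i, rfl⟩

theorem apply_colAlt_tprod (B : Wedge2 (Sym2Sub W) →ₗ[ℂ] Wedge2 (Sym2Sub W) →ₗ[ℂ] X)
    (hB : ∀ s t, B s t = B t s) (Ψ : (⨂[ℂ]^8 W) →ₗ[ℂ] X)
    (hΨ : ∀ v : Fin 8 → W, Ψ (tprod ℂ v) = (16 : ℂ) •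
      B (cubic (v 0) (v 1) (v 2) (v 3)) (cubic (v 4) (v 5) (v 6) (v 7))) (w : ℕ → W) :
    Ψ (colAlt W 8 (fun k => colIdx [4, 3, 1] k)
      (tprod ℂ fun k : Fin 8 => w (rowIdx [4, 3, 1] k))) =
      (-128 : ℂ) • pluecker B (symProd W (w 0) (w 0)) (symProd W (w 0) (w 1))
        (symProd W (w 0) (w 2)) (symProd W (w 1) (w 1)) := by
  obtain ⟨u, hu⟩ : ∃ u : Fin 8 → W, u = fun k : Fin 8 => w (rowIdx [4, 3, 1] k) := ⟨_, rfl⟩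
  obtain ⟨f, hf⟩ : ∃ f : W → W → W → X, ∀ p q r, f p q r =
      B (cubic p (w 0) (w 0) (w 0)) (cubic q (w 1) (w 1) r) -
      B (cubic p (w 0) (w 1) (w 0)) (cubic q (w 1) (w 0) r) -
      B (cubic p (w 1) (w 0) (w 0)) (cubic q (w 0) (w 1) r) +
      B (cubic p (w 1) (w 1) (w 0)) (cubic q (w 0) (w 0) r) := ⟨_, fun _ _ _ => rfl⟩
  have u0 : u 0 = w 0 := by rw [hu]; rfl
  have u1 : u 1 = w 0 := by rw [hu]; rfl
  have u2 : u 2 = w 0 := by rw [hu]; rfl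
  have u3 : u 3 = w 0 := by rw [hu]; rfl
  have u4 : u 4 = w 1 := by rw [hu]; rfl
  have u5 : u 5 = w 1 := by rw [hu]; rfl
  have u6 : u 6 = w 1 := by rw [hu]; rfl
  have u7 : u 7 = w 2 := by rw [hu]; rfl
  have h₁ := sum_sign_perm_columns (fun i₀ i₁ i₂ i₃ i₄ i₅ i₆ i₇ =>
    B (cubic (u i₀) (u i₁) (u i₂) (u i₃)) (cubic (u i₄) (u i₅) (u i₆) (u i₇)))
    (fun p q r => f (u p) (u q) (u r))
    (fun p q r => by simp only [hf, u1, u2, u3, u5, u6])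
  have h₂ := sum_cubic_mul_cubic B hB f (w 0) (w 1) (w 2) hf
  simp only [u0, u4, u7] at h₁
  rw [← hu, colAlt_tprod, map_sum]
  simp only [map_smul, hΨ]
  simp only [smul_comm _ (16 : ℂ)]
  rw [← Finset.smul_sum, h₁, h₂, smul_smul]
  norm_num

theorem map_schurModule (n : ℕ) (l : List ℕ) (Ψ : (⨂[ℂ]^n W) →ₗ[ℂ] X) :
    (SchurModule W n l).map Ψ = Submodule.span ℂ (Set.range fun w : ℕ → W =>
      Ψ (colAlt W n (fun k => colIdx l k) (tprod ℂ fun k : Fin n => w (rowIdx l k)))) := by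
  rw [SchurModule, youngSymmetrizer_eq, LinearMap.range_comp, range_rowSym, ← Submodule.map_comp,
    Submodule.map_span, ← Set.range_comp]
  rfl

theorem map_schurModule_four_three_one
    (B : Wedge2 (Sym2Sub W) →ₗ[ℂ] Wedge2 (Sym2Sub W) →ₗ[ℂ] X)
    (hB : ∀ s t, B s t = B t s) (Ψ : (⨂[ℂ]^8 W) →ₗ[ℂ] X)
    (hΨ : ∀ v : Fin 8 → W, Ψ (tprod ℂ v) = (16 : ℂ) •
      B (cubic (v 0) (v 1) (v 2) (v 3)) (cubic (v 4) (v 5) (v 6) (v 7))) :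
    (SchurModule W 8 [4, 3, 1]).map Ψ =
      Submodule.span ℂ (Set.range fun w : ℕ → W => pluecker B (symProd W (w 0) (w 0))
        (symProd W (w 0) (w 1)) (symProd W (w 0) (w 2)) (symProd W (w 1) (w 1))) := by
  rw [map_schurModule]
  exact span_range_eq_of_eq_smul (by norm_num) (apply_colAlt_tprod B hB Ψ hΨ)

theorem smul_four_apply {D : Type} [AddCommGroup D] [Module ℂ D] (B : D →ₗ[ℂ] D →ₗ[ℂ] X)
    (s t : D) : B ((4 : ℂ) • s) ((4 : ℂ) • t) = (16 : ℂ) • B s t := by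
  rw [map_smul, map_smul, LinearMap.smul_apply, smul_smul]
  norm_num

/-- The projection-and-multiplication map `⨂⁸ W → Sym²(S_{(3,1)} W)`. -/
def schurMul (W : Type) [AddCommGroup W] [Module ℂ W] :
    (⨂[ℂ]^8 W) →ₗ[ℂ] SymmAlgebra (SchurModule W 4 [3, 1, 0]) :=
  mulTwo W 4 _ (ιSym _ ∘ₗ toSchur W)

theorem schurMul_tprod (v : Fin 8 → W) : schurMul W (tprod ℂ v) =
    symMul _ (schur (v 0) (v 1) (v 2) (v 3)) (schur (v 4) (v 5) (v 6) (v 7)) := by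
  refine (mulTwo_tprod 4 _ v).trans ?_
  rw [LinearMap.comp_apply, LinearMap.comp_apply, toSchur_tprod, toSchur_tprod]
  rfl

theorem symCongr_schurMul_tprod (v : Fin 8 → W) :
    symCongr (schurEquiv W) (schurMul W (tprod ℂ v)) = (16 : ℂ) •
      symMul _ (cubic (v 0) (v 1) (v 2) (v 3)) (cubic (v 4) (v 5) (v 6) (v 7)) := by
  rw [schurMul_tprod, symCongr_symMul, schurEquiv_schur, schurEquiv_schur]
  exact smul_four_apply _ _ _

theorem map_schurRelations : (U₁ W).map (symCongr (schurEquiv W)).toLinearMap =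
    Submodule.span ℂ (Set.range fun w : ℕ → W => symPluecker (symProd W (w 0) (w 0))
      (symProd W (w 0) (w 1)) (symProd W (w 0) (w 2)) (symProd W (w 1) (w 1))) := by
  have h : U₁ W = (SchurModule W 8 [4, 3, 1]).map (schurMul W) := rfl
  rw [h, ← Submodule.map_comp]
  exact map_schurModule_four_three_one (symMul (Wedge2 (Sym2Sub W))) symMul_comm _ symCongr_schurMul_tprod

end SchurRelations

section PlueckerRelations

variable {V X : Type} [AddCommGroup V] [Module ℂ V] [AddCommGroup X] [Module ℂ X]
  {B : Wedge2 V →ₗ[ℂ] Wedge2 V →ₗ[ℂ] X}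

theorem pluecker_swap_two_three (a b c d : V) : pluecker B a b c d = -pluecker B a c b d := by
  simp only [pluecker, wedge_swap b c, map_neg]
  abel

theorem pluecker_swap_three_four (a b c d : V) : pluecker B a b c d = -pluecker B a b d c := by
  simp only [pluecker, wedge_swap c d, map_neg]
  abel

theorem pluecker_swap_one_two (hB : ∀ s t, B s t = B t s) (a b c d : V) :
    pluecker B a b c d = -pluecker B b a c d := by
  simp only [pluecker, wedge_swap a b, map_neg, LinearMap.neg_apply, hB (wedge V b c),
    hB (wedge V b d)]
  abel

theorem pluecker_self_two_three (a b d : V) : pluecker B a b b d = 0 := by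
  simp [pluecker]

theorem pluecker_self_three_four (a b c : V) : pluecker B a b c c = 0 := by
  simp [pluecker]

theorem pluecker_self_one_two (hB : ∀ s t, B s t = B t s) (a c d : V) :
    pluecker B a a c d = 0 := by
  simp [pluecker, hB (wedge V a d)]

theorem pluecker_add_smul_one (k : ℂ) (a a' b c d : V) :
    pluecker B (a + k • a') b c d = pluecker B a b c d + k • pluecker B a' b c d := by
  simp only [pluecker, map_add, map_smul, LinearMap.add_apply, LinearMap.smul_apply]
  module

theorem pluecker_add_smul_two (k : ℂ) (a b b' c d : V) :
    pluecker B a (b + k • b') c d = pluecker B a b c d + k • pluecker B a b' c d := by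
  simp only [pluecker, map_add, map_smul, LinearMap.add_apply, LinearMap.smul_apply]
  module

theorem pluecker_add_smul_three (k : ℂ) (a b c c' d : V) :
    pluecker B a b (c + k • c') d = pluecker B a b c d + k • pluecker B a b c' d := by
  simp only [pluecker, map_add, map_smul, LinearMap.add_apply, LinearMap.smul_apply]
  module

theorem pluecker_add_smul_four (k : ℂ) (a b c d d' : V) :
    pluecker B a b c (d + k • d') = pluecker B a b c d + k • pluecker B a b c d' := by
  simp only [pluecker, map_add, map_smul, LinearMap.add_apply, LinearMap.smul_apply]
  module

theorem forall_of_sorted {ι : Type} [LinearOrder ι] {P : ι → ι → ι → ι → Prop}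
    (h₁ : ∀ i j k l, P i j k l → P j i k l) (h₂ : ∀ i j k l, P i j k l → P i k j l)
    (h₃ : ∀ i j k l, P i j k l → P i j l k)
    (h : ∀ i j k l, i ≤ j → j ≤ k → k ≤ l → P i j k l) (i j k l : ι) : P i j k l := by
  have s₁ : ∀ i j k l, i ≤ j → j ≤ k → P i j k l := fun i j k l hij hjk => by
    rcases le_total k l with hkl | hkl
    · exact h _ _ _ _ hij hjk hkl
    rcases le_total j l with hjl | hjl
    · exact h₃ _ _ _ _ (h _ _ _ _ hij hjl hkl)
    rcases le_total i l with hil | hil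
    · exact h₃ _ _ _ _ (h₂ _ _ _ _ (h _ _ _ _ hil hjl hjk))
    · exact h₃ _ _ _ _ (h₂ _ _ _ _ (h₁ _ _ _ _ (h _ _ _ _ hil hij hjk)))
  have s₂ : ∀ i j k l, i ≤ j → P i j k l := fun i j k l hij => by
    rcases le_total j k with hjk | hjk
    · exact s₁ _ _ _ _ hij hjk
    rcases le_total i k with hik | hik
    · exact h₂ _ _ _ _ (s₁ _ _ _ _ hik hjk)
    · exact h₂ _ _ _ _ (h₁ _ _ _ _ (s₁ _ _ _ _ hik hij))
  rcases le_total i j with hij | hij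
  · exact s₂ _ _ _ _ hij
  · exact h₁ _ _ _ _ (s₂ _ _ _ _ hij)

/-- If a spanning family satisfies the Plücker relations with strictly increasing indices modulo
`U`, then all Plücker relations hold modulo `U`. -/
theorem pluecker_mem_of_span_eq_top {ι : Type} [LinearOrder ι] (hB : ∀ s t, B s t = B t s)
    (e : ι → V) (he : Submodule.span ℂ (Set.range e) = ⊤) (U : Submodule ℂ X)
    (h : ∀ i j k l, i < j → j < k → k < l → pluecker B (e i) (e j) (e k) (e l) ∈ U)
    (a b c d : V) : pluecker B a b c d ∈ U := by
  have h₁ : ∀ a b c d, pluecker B a b c d ∈ U → pluecker B b a c d ∈ U := fun a b c d h => by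
    rwa [pluecker_swap_one_two hB, neg_mem_iff]
  have h₂ : ∀ a b c d, pluecker B a b c d ∈ U → pluecker B a c b d ∈ U := fun a b c d h => by
    rwa [pluecker_swap_two_three, neg_mem_iff]
  have h₃ : ∀ a b c d, pluecker B a b c d ∈ U → pluecker B a b d c ∈ U := fun a b c d h => by
    rwa [pluecker_swap_three_four, neg_mem_iff]
  have hfirst : ∀ b c d, (∀ i, pluecker B (e i) b c d ∈ U) → ∀ a, pluecker B a b c d ∈ U := by
    intro b c d hi a
    have ha : a ∈ Submodule.span ℂ (Set.range e) := he ▸ Submodule.mem_top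
    induction ha using Submodule.span_induction with
    | mem x hx =>
      obtain ⟨i, rfl⟩ := hx
      exact hi i
    | zero => simp [pluecker]
    | add x y _ _ hx hy =>
      have := pluecker_add_smul_one (B := B) 1 x y b c d
      rw [one_smul, one_smul] at this
      rw [this]
      exact U.add_mem hx hy
    | smul k x _ hx =>
      have := pluecker_add_smul_one (B := B) k 0 x b c d
      rw [zero_add] at this
      rw [this]
      exact U.add_mem (by simp [pluecker]) (U.smul_mem _ hx)
  have hind : ∀ i j k l, pluecker B (e i) (e j) (e k) (e l) ∈ U := by
    refine forall_of_sorted (fun i j k l => h₁ _ _ _ _) (fun i j k l => h₂ _ _ _ _)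
      (fun i j k l => h₃ _ _ _ _) fun i j k l hij hjk hkl => ?_
    rcases hij.eq_or_lt with rfl | hij
    · simp [pluecker_self_one_two hB]
    rcases hjk.eq_or_lt with rfl | hjk
    · simp [pluecker_self_two_three]
    rcases hkl.eq_or_lt with rfl | hkl
    · simp [pluecker_self_three_four]
    exact h i j k l hij hjk hkl
  refine hfirst b c d (fun i => h₁ _ _ _ _ ?_) a
  refine hfirst _ c d (fun j => h₂ _ _ _ _ (h₁ _ _ _ _ ?_)) b
  refine hfirst _ _ d (fun k => h₃ _ _ _ _ (h₂ _ _ _ _ (h₁ _ _ _ _ ?_))) c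
  exact hfirst _ _ _ (fun l => hind _ _ _ _) d

theorem U₃_eq_span : U₃ V = Submodule.span ℂ
    (Set.range fun v : Fin 4 → V => symPluecker (v 0) (v 1) (v 2) (v 3)) := by
  apply le_antisymm
  · exact U₃_le _ fun a b c d => Submodule.subset_span ⟨![a, b, c, d], rfl⟩
  · rw [Submodule.span_le]
    rintro _ ⟨v, rfl⟩
    exact pluecker_mem_U₃ _ _ _ _

end PlueckerRelations

section SymmetricSquareBasis

variable {W : Type} [AddCommGroup W] [Module ℂ W]

/-- The products `b_i b_j` with `i ≤ j`, in lexicographic order. -/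
def symFamily (b : Fin 3 → W) : Fin 6 → Sym2Sub W :=
  ![symProd W (b 0) (b 0), symProd W (b 0) (b 1), symProd W (b 0) (b 2), symProd W (b 1) (b 1),
    symProd W (b 1) (b 2), symProd W (b 2) (b 2)]

theorem span_symFamily (b : Module.Basis (Fin 3) ℂ W) :
    Submodule.span ℂ (Set.range (symFamily b)) = ⊤ := by
  have hmem : ∀ i, symFamily b i ∈ Submodule.span ℂ (Set.range (symFamily b)) :=
    fun i => Submodule.subset_span ⟨i, rfl⟩
  have hb : (symProd W).compr₂ (Submodule.span ℂ (Set.range (symFamily b))).mkQ = 0 := by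
    refine b.ext fun i => b.ext fun j => ?_
    simp only [LinearMap.compr₂_apply, LinearMap.zero_apply, Submodule.mkQ_apply,
      Submodule.Quotient.mk_eq_zero]
    fin_cases i <;> fin_cases j
    · exact hmem 0
    · exact hmem 1
    · exact hmem 2
    · exact symProd_comm (b 0) (b 1) ▸ hmem 1
    · exact hmem 3
    · exact hmem 4
    · exact symProd_comm (b 0) (b 2) ▸ hmem 2
    · exact symProd_comm (b 1) (b 2) ▸ hmem 4
    · exact hmem 5
  have h : (Submodule.span ℂ (Set.range (symFamily b))).mkQ = 0 :=
    sym2_hom_ext fun u v => LinearMap.congr_fun₂ hb u v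
  rw [← Submodule.ker_mkQ (Submodule.span ℂ (Set.range (symFamily b))), h, LinearMap.ker_zero]

/-- The `(i, j)` coordinate of a symmetric tensor. -/
def symCoord (b : Module.Basis (Fin 3) ℂ W) (i j : Fin 3) : Sym2Sub W →ₗ[ℂ] ℂ :=
  liftPair ((LinearMap.mul ℂ ℂ).compl₁₂ (b.coord i) (b.coord j)) ∘ₗ (Sym2Sub W).subtype

theorem symCoord_symProd (b : Module.Basis (Fin 3) ℂ W) (i j : Fin 3) (u v : W) :
    symCoord b i j (symProd W u v) = b.coord i u * b.coord j v + b.coord i v * b.coord j u := by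
  rw [symCoord, LinearMap.comp_apply, Submodule.subtype_apply, coe_symProd, map_add,
    liftPair_tprodPair, liftPair_tprodPair]
  rfl

theorem linearIndependent_symFamily (b : Module.Basis (Fin 3) ℂ W) :
    LinearIndependent ℂ (symFamily b) := by
  let T : Sym2Sub W →ₗ[ℂ] Fin 6 → ℂ := LinearMap.pi ![(1 / 2 : ℂ) • symCoord b 0 0,
    symCoord b 0 1, symCoord b 0 2, (1 / 2 : ℂ) • symCoord b 1 1, symCoord b 1 2,
    (1 / 2 : ℂ) • symCoord b 2 2]
  have hT : T ∘ symFamily b = Pi.basisFun ℂ (Fin 6) := by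
    ext i j
    fin_cases i <;> fin_cases j <;>
      simp [T, symFamily, symCoord_symProd]
    all_goals norm_num
  refine LinearIndependent.of_comp T ?_
  rw [hT]
  exact (Pi.basisFun ℂ (Fin 6)).linearIndependent

/-- A basis of `Sym² W` for a three-dimensional `W`. -/
def symBasis (b : Module.Basis (Fin 3) ℂ W) : Module.Basis (Fin 6) ℂ (Sym2Sub W) :=
  Module.Basis.mk (linearIndependent_symFamily b) (span_symFamily b).ge

end SymmetricSquareBasis

section SpecialRelations

variable {W X : Type} [AddCommGroup W] [Module ℂ W] [AddCommGroup X] [Module ℂ X]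
  {B : Wedge2 (Sym2Sub W) →ₗ[ℂ] Wedge2 (Sym2Sub W) →ₗ[ℂ] X} {U : Submodule ℂ X}

theorem symProd_add_smul_self (k : ℂ) (x z : W) : symProd W (x + k • z) (x + k • z) =
    (symProd W x x + (2 * k) • symProd W x z) + (k * k) • symProd W z z := by
  simp only [map_add, LinearMap.add_apply, map_smul, LinearMap.smul_apply, symProd_comm z x]
  module

theorem symProd_add_smul_left (k : ℂ) (x y z : W) : symProd W (x + k • z) y =
    symProd W x y + k • symProd W y z := by
  simp only [map_add, LinearMap.add_apply, map_smul, LinearMap.smul_apply, symProd_comm z y]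

theorem symProd_add_smul_right (k : ℂ) (x y z : W) : symProd W x (y + k • z) =
    symProd W x y + k • symProd W x z := by
  simp only [map_add, map_smul]

theorem pluecker_mixed_mem
    (hU : ∀ x y z : W, pluecker B (symProd W x x) (symProd W x y) (symProd W x z)
      (symProd W y y) ∈ U) (x y z : W) :
    pluecker B (symProd W x x) (symProd W x y) (symProd W x z) (symProd W y z) ∈ U := by
  have h := hU x (y + (1 : ℂ) • z) z
  have hy := hU x y z
  have hz := hU x z y
  rw [pluecker_swap_two_three] at hz
  rw [symProd_add_smul_right, symProd_add_smul_self] at h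
  generalize symProd W x x = a at *
  generalize symProd W x y = b at *
  generalize symProd W x z = c at *
  generalize symProd W y y = d at *
  generalize symProd W y z = f at *
  generalize symProd W z z = g at *
  rw [pluecker_add_smul_two, pluecker_self_two_three, smul_zero, add_zero, pluecker_add_smul_four,
    pluecker_add_smul_four] at h
  have key : pluecker B a b c f = (1 / 2 : ℂ) • ((pluecker B a b c d + (2 * 1 : ℂ) •
      pluecker B a b c f + (1 * 1 : ℂ) • pluecker B a b c g) - pluecker B a b c d +
      -pluecker B a b c g) := by
    module
  rw [key]
  exact U.smul_mem _ (U.add_mem (U.sub_mem h hy) hz)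

theorem pluecker_sub_mem (hB : ∀ s t, B s t = B t s)
    (hU : ∀ x y z : W, pluecker B (symProd W x x) (symProd W x y) (symProd W x z)
      (symProd W y y) ∈ U) (x y z : W) :
    pluecker B (symProd W x x) (symProd W y z) (symProd W z z) (symProd W y y) -
      pluecker B (symProd W x y) (symProd W x z) (symProd W z z) (symProd W y y) ∈ U := by
  have h := hU x y z
  have hp := hU (x + (1 : ℂ) • z) y z
  have hm := hU (x + (-1 : ℂ) • z) y z
  rw [symProd_add_smul_self, symProd_add_smul_left, symProd_add_smul_left] at hp hm
  generalize symProd W x x = a at *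
  generalize symProd W x y = b at *
  generalize symProd W x z = c at *
  generalize symProd W y y = d at *
  generalize symProd W y z = f at *
  generalize symProd W z z = g at *
  have e₁ : pluecker B c b g d = -pluecker B b c g d := pluecker_swap_one_two hB _ _ _ _
  have e₂ : pluecker B g b c d = pluecker B b c g d := by
    rw [pluecker_swap_one_two hB, pluecker_swap_two_three, neg_neg]
  have e₃ : ∀ s t, pluecker B s t s d = 0 := fun s t => by
    rw [pluecker_swap_two_three, pluecker_self_one_two hB, neg_zero]
  simp only [pluecker_add_smul_one, pluecker_add_smul_two, pluecker_add_smul_three, e₁, e₂, e₃]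
    at hp hm
  have key := U.sub_mem (U.smul_mem (1 / 2 : ℂ) (U.add_mem hp hm)) h
  convert key using 1
  module

theorem pluecker_squares_mem (hB : ∀ s t, B s t = B t s)
    (hU : ∀ x y z : W, pluecker B (symProd W x x) (symProd W x y) (symProd W x z)
      (symProd W y y) ∈ U) (x y z : W) :
    pluecker B (symProd W x x) (symProd W y z) (symProd W z z) (symProd W y y) ∈ U ∧
      pluecker B (symProd W x y) (symProd W x z) (symProd W z z) (symProd W y y) ∈ U := by
  have h := pluecker_sub_mem hB hU x y z
  have h' := pluecker_sub_mem hB hU x z y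
  rw [symProd_comm z y, pluecker_swap_three_four, pluecker_swap_one_two hB (symProd W x z),
    pluecker_swap_three_four (symProd W x y), neg_neg] at h'
  constructor
  · convert U.smul_mem (1 / 2 : ℂ) (U.sub_mem h h') using 1
    module
  · convert U.smul_mem (-1 / 2 : ℂ) (U.add_mem h h') using 1
    module

/-- A permutation-invariant relation on four indices in `Fin 6` holds for all increasing indices
as soon as it holds for each four-element set of indices, in some order. -/
theorem forall_lt_of_perm_invariant {P : Fin 6 → Fin 6 → Fin 6 → Fin 6 → Prop}
    (h₁ : ∀ i j k l, P i j k l → P j i k l) (h₂ : ∀ i j k l, P i j k l → P i k j l)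
    (h₃ : ∀ i j k l, P i j k l → P i j l k)
    (hA : P 0 1 2 3 ∧ P 0 2 1 5 ∧ P 3 1 4 0 ∧ P 3 4 1 5 ∧ P 5 2 4 0 ∧ P 5 4 2 3)
    (hM : P 0 1 2 4 ∧ P 3 1 4 2 ∧ P 5 2 4 1)
    (hS : P 0 4 5 3 ∧ P 3 2 5 0 ∧ P 5 1 3 0) (hS' : P 1 2 5 3 ∧ P 1 4 5 0 ∧ P 2 4 3 0)
    (i j k l : Fin 6) (hij : i < j) (hjk : j < k) (hkl : k < l) : P i j k l := by
  have hmem : (i, j, k, l) ∈ ([(0, 1, 2, 3), (0, 1, 2, 4), (0, 1, 2, 5), (0, 1, 3, 4),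
      (0, 1, 3, 5), (0, 1, 4, 5), (0, 2, 3, 4), (0, 2, 3, 5), (0, 2, 4, 5), (0, 3, 4, 5),
      (1, 2, 3, 4), (1, 2, 3, 5), (1, 2, 4, 5), (1, 3, 4, 5), (2, 3, 4, 5)] :
      List (Fin 6 × Fin 6 × Fin 6 × Fin 6)) := by
    clear * - hij hjk hkl
    revert i j k l
    decide
  have h : ∀ i j k l, P i j k l ↔ P j i k l := fun i j k l => ⟨h₁ _ _ _ _, h₁ _ _ _ _⟩
  have h' : ∀ i j k l, P i j k l ↔ P i k j l := fun i j k l => ⟨h₂ _ _ _ _, h₂ _ _ _ _⟩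
  have h'' : ∀ i j k l, P i j k l ↔ P i j l k := fun i j k l => ⟨h₃ _ _ _ _, h₃ _ _ _ _⟩
  clear h₁ h₂ h₃ hij hjk hkl
  simp only [List.mem_cons, Prod.mk.injEq, List.not_mem_nil, or_false] at hmem
  rcases hmem with h | h | h | h | h | h | h | h | h | h | h | h | h | h | h <;>
    obtain ⟨rfl, rfl, rfl, rfl⟩ := h <;> grind

theorem pluecker_mem_of_finrank_eq_three [FiniteDimensional ℂ W] (hW : Module.finrank ℂ W = 3)
    (hB : ∀ s t, B s t = B t s)
    (hU : ∀ x y z : W, pluecker B (symProd W x x) (symProd W x y) (symProd W x z)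
      (symProd W y y) ∈ U) (s t u v : Sym2Sub W) : pluecker B s t u v ∈ U := by
  let b := Module.finBasisOfFinrankEq ℂ W hW
  have h₁ := symProd_comm (b 1) (b 0)
  have h₂ := symProd_comm (b 2) (b 0)
  have h₃ := symProd_comm (b 2) (b 1)
  have hM := pluecker_mixed_mem hU
  have hS := fun x y z => (pluecker_squares_mem hB hU x y z).1
  have hS' := fun x y z => (pluecker_squares_mem hB hU x y z).2
  have hA := And.intro (hU (b 0) (b 1) (b 2)) <| And.intro (hU (b 0) (b 2) (b 1)) <|
    And.intro (hU (b 1) (b 0) (b 2)) <| And.intro (hU (b 1) (b 2) (b 0)) <|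
    And.intro (hU (b 2) (b 0) (b 1)) (hU (b 2) (b 1) (b 0))
  replace hM := And.intro (hM (b 0) (b 1) (b 2)) <| And.intro (hM (b 1) (b 0) (b 2))
    (hM (b 2) (b 0) (b 1))
  replace hS := And.intro (hS (b 0) (b 1) (b 2)) <| And.intro (hS (b 1) (b 0) (b 2))
    (hS (b 2) (b 0) (b 1))
  replace hS' := And.intro (hS' (b 0) (b 1) (b 2)) <| And.intro (hS' (b 1) (b 0) (b 2))
    (hS' (b 2) (b 0) (b 1))
  simp only [h₁, h₂, h₃] at hA hM hS hS'
  refine pluecker_mem_of_span_eq_top hB _ (span_symFamily b) U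
    (forall_lt_of_perm_invariant (fun i j k l h => ?_) (fun i j k l h => ?_)
      (fun i j k l h => ?_) hA hM hS hS') s t u v
  · rwa [pluecker_swap_one_two hB, neg_mem_iff]
  · rwa [pluecker_swap_two_three, neg_mem_iff]
  · rwa [pluecker_swap_three_four, neg_mem_iff]

end SpecialRelations

theorem span_pluecker_eq {W X : Type} [AddCommGroup W] [Module ℂ W] [FiniteDimensional ℂ W]
    [AddCommGroup X] [Module ℂ X] (hW : Module.finrank ℂ W = 3)
    {B : Wedge2 (Sym2Sub W) →ₗ[ℂ] Wedge2 (Sym2Sub W) →ₗ[ℂ] X} (hB : ∀ s t, B s t = B t s) :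
    Submodule.span ℂ (Set.range fun w : ℕ → W => pluecker B (symProd W (w 0) (w 0))
      (symProd W (w 0) (w 1)) (symProd W (w 0) (w 2)) (symProd W (w 1) (w 1))) =
    Submodule.span ℂ (Set.range fun v : Fin 4 → Sym2Sub W =>
      pluecker B (v 0) (v 1) (v 2) (v 3)) := by
  apply le_antisymm <;> rw [Submodule.span_le]
  · rintro _ ⟨w, rfl⟩
    exact Submodule.subset_span ⟨![symProd W (w 0) (w 0), symProd W (w 0) (w 1),
      symProd W (w 0) (w 2), symProd W (w 1) (w 1)], rfl⟩
  · rintro _ ⟨v, rfl⟩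
    refine pluecker_mem_of_finrank_eq_three hW hB (fun x y z => ?_) _ _ _ _
    exact Submodule.subset_span ⟨fun n => if n = 0 then x else if n = 1 then y else z, rfl⟩

theorem map_U₁ {W : Type} [AddCommGroup W] [Module ℂ W] [FiniteDimensional ℂ W]
    (hW : Module.finrank ℂ W = 3) :
    (U₁ W).map (symCongr (schurEquiv W)).toLinearMap = U₃ (Sym2Sub W) := by
  rw [U₃_eq_span]
  exact map_schurRelations.trans (span_pluecker_eq hW (B := symMul _) symMul_comm)

/-- The isomorphism `S_{(3,1)} W ≃ ⋀²(Sym² W)`. -/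
def schurEquivWedge2Sym2 (W : Type) [AddCommGroup W] [Module ℂ W] :
    SchurModule W 4 [3, 1, 0] ≃ₗ[ℂ] Wedge2Sym2 W := schurEquiv W

theorem map_U₁_eq_U₂ {W : Type} [AddCommGroup W] [Module ℂ W] [FiniteDimensional ℂ W]
    (hW : Module.finrank ℂ W = 3) :
    (U₁ W).map (symCongr (schurEquivWedge2Sym2 W)).toLinearMap = U₂ W := map_U₁ hW

/-- The isomorphism `⋀²(Sym² W) ≃ ⋀² V` induced by an isomorphism `Sym² W ≃ V`. -/
def wedge2Sym2Congr {W V : Type} [AddCommGroup W] [Module ℂ W] [AddCommGroup V] [Module ℂ V]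
    (g : Sym2Sub W ≃ₗ[ℂ] V) : Wedge2Sym2 W ≃ₗ[ℂ] BlockModule V 2 [(2, true)] := wedge2Congr g

theorem map_U₂_eq_U₃ {W V : Type} [AddCommGroup W] [Module ℂ W] [AddCommGroup V] [Module ℂ V]
    (g : Sym2Sub W ≃ₗ[ℂ] V) :
    (U₂ W).map (symCongr (wedge2Sym2Congr g)).toLinearMap = U₃ V := U₃_map g

theorem exists_algEquiv_U₂_U₃ {W V : Type} [AddCommGroup W] [Module ℂ W] [AddCommGroup V]
    [Module ℂ V] (g : Sym2Sub W ≃ₗ[ℂ] V) :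
    ∃ e : quotBy (SymmAlgebra ↥(Wedge2Sym2 W)) ↑(U₂ W) ≃ₐ[ℂ]
        quotBy (SymmAlgebra ↥(BlockModule V 2 [(2, true)])) ↑(U₃ V),
      Submodule.map e.toLinearMap (LinearMap.range (gen₁ (↥(Wedge2Sym2 W)) ↑(U₂ W))) =
        LinearMap.range (gen₁ (↥(BlockModule V 2 [(2, true)])) ↑(U₃ V)) :=
  exists_quotBy_algEquiv (wedge2Sym2Congr g) (U₂ W) (U₃ V) (map_U₂_eq_U₃ g)

theorem exists_algEquiv_U₁_U₂ {W : Type} [AddCommGroup W] [Module ℂ W]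
    [FiniteDimensional ℂ W] (hW : Module.finrank ℂ W = 3) :
    ∃ e : quotBy (SymmAlgebra ↥(SchurModule W 4 [3, 1, 0])) ↑(U₁ W) ≃ₐ[ℂ]
        quotBy (SymmAlgebra ↥(Wedge2Sym2 W)) ↑(U₂ W),
      Submodule.map e.toLinearMap (LinearMap.range (gen₁ (↥(SchurModule W 4 [3, 1, 0])) ↑(U₁ W))) =
        LinearMap.range (gen₁ (↥(Wedge2Sym2 W)) ↑(U₂ W)) :=
  exists_quotBy_algEquiv (schurEquivWedge2Sym2 W) (U₁ W) (U₂ W) (map_U₁_eq_U₂ hW)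

/-- Example 2.12 of the paper.  For `W` a 3-dimensional and `W'` a 6-dimensional complex
vector space, there are graded `ℂ`-algebra isomorphisms
`Sym^•(S_{(3,1,0)}W)/⟨S_{(4,3,1)}W⟩ ≅ Sym^•(⋀²(Sym²W))/⟨⋀⁴(Sym²W)⟩ ≅ Sym^•(⋀²W')/⟨⋀⁴W'⟩`,
the last being the homogeneous coordinate ring of the cone over the Plücker embedding of the
Grassmannian `G(2,6)`.  "Graded" is expressed by the isomorphisms carrying the degree-one part
onto the degree-one part (the algebras are generated in degree one). -/
theorem stmt_19 (W W' : Type)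
    [AddCommGroup W] [Module ℂ W] [FiniteDimensional ℂ W]
    [AddCommGroup W'] [Module ℂ W'] [FiniteDimensional ℂ W']
    (hW : Module.finrank ℂ W = 3) (hW' : Module.finrank ℂ W' = 6) :
    ∃ e₁ : quotBy (SymmAlgebra ↥(SchurModule W 4 [3, 1, 0])) ↑(U₁ W) ≃ₐ[ℂ]
        quotBy (SymmAlgebra ↥(Wedge2Sym2 W)) ↑(U₂ W),
      Submodule.map e₁.toLinearMap (LinearMap.range (gen₁ (↥(SchurModule W 4 [3, 1, 0])) ↑(U₁ W))) =
        LinearMap.range (gen₁ (↥(Wedge2Sym2 W)) ↑(U₂ W)) ∧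
      ∃ e₂ : quotBy (SymmAlgebra ↥(Wedge2Sym2 W)) ↑(U₂ W) ≃ₐ[ℂ]
          quotBy (SymmAlgebra ↥(BlockModule W' 2 [(2, true)])) ↑(U₃ W'),
        Submodule.map e₂.toLinearMap (LinearMap.range (gen₁ (↥(Wedge2Sym2 W)) ↑(U₂ W))) =
          LinearMap.range (gen₁ (↥(BlockModule W' 2 [(2, true)])) ↑(U₃ W')) := by
  have h := exists_algEquiv_U₂_U₃ ((symBasis (Module.finBasisOfFinrankEq ℂ W hW)).equiv
    (Module.finBasisOfFinrankEq ℂ W' hW') (Equiv.refl _))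
  exact (exists_algEquiv_U₁_U₂ hW).imp fun _ h₁ => ⟨h₁, h⟩

end
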